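/- There is a universal constant C > 0 such that for all p, q with p* ∈ [2,∞) and q ∈ [2,∞), all positive integers m, n, and every real m×n matrix A = (a_{ij}): E‖G_A‖_{p→q} ≤ C·( √(p*)·D1 + √q·D2 + Log^5(mn)·max_{i,j} |a_{ij}| ). -/

import Mathlib

open MeasureTheory ProbabilityTheory
open scoped ENNReal NNReal

noncomputable section

/-- The `ℓ_r` norm of a finite real vector, `r ∈ [1,∞]`. -/
def lpNorm (r : ℝ≥0∞) {ι : Type*} [Fintype ι] (x : ι → ℝ) : ℝ :=
  if r = ⊤ then ⨆ i, |x i| else (∑ i, |x i| ^ r.toReal) ^ (1 / r.toReal)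

/-- The operator norm `‖M‖_{p→q}` expressed via the conjugate exponent `q*`:
the supremum of the bilinear form over `s` in the unit ball of `ℓ_{q*}` and
`t` in the unit ball of `ℓ_p`. -/
def opNorm (p qstar : ℝ≥0∞) {ι κ : Type*} [Fintype ι] [Fintype κ]
    (M : ι → κ → ℝ) : ℝ :=
  sSup { x : ℝ | ∃ s : ι → ℝ, ∃ t : κ → ℝ,
    lpNorm qstar s ≤ 1 ∧ lpNorm p t ≤ 1 ∧ x = ∑ i, ∑ j, M i j * s i * t j }

/-- The standard Gaussian product measure on `ι → ℝ` (iid `N(0,1)` coordinates). -/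
def stdGaussian (ι : Type*) [Fintype ι] : Measure (ι → ℝ) :=
  Measure.pi fun _ => gaussianReal 0 1

/-- `Log x = max 1 (ln x)`; in particular `Log 0 = 1`. -/
def Log (x : ℝ) : ℝ := max 1 (Real.log x)

/-- `E‖G_A‖_{p→q}` for the Gaussian matrix `G_A = (a_{ij} g_{ij})`. -/
def EopNorm (p qstar : ℝ≥0∞) {m n : ℕ} (A : Fin m → Fin n → ℝ) : ℝ :=
  ∫ g : Fin m × Fin n → ℝ,
    opNorm p qstar (fun i j => A i j * g (i, j)) ∂ stdGaussian (Fin m × Fin n)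

/-- `D1 = max_i ‖(a_{ij})_j‖_{p*}`. -/
def D1 (pstar : ℝ≥0∞) {m n : ℕ} (A : Fin m → Fin n → ℝ) : ℝ :=
  ⨆ i, lpNorm pstar (fun j => A i j)

/-- `D2 = max_j ‖(a_{ij})_i‖_q`. -/
def D2 (q : ℝ≥0∞) {m n : ℕ} (A : Fin m → Fin n → ℝ) : ℝ :=
  ⨆ j, lpNorm q (fun i => A i j)

/-- `max_{i,j} |a_{ij}|`. -/
def maxEntry {m n : ℕ} (A : Fin m → Fin n → ℝ) : ℝ :=
  ⨆ ij : Fin m × Fin n, |A ij.1 ij.2|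

/-- `max_{k ≥ 0} inf_{I ⊂ [m]×[n], |I| = k} √(Log k) · max_{(i,j) ∉ I} |a_{ij}|`
(for `k > mn` the term vanishes, so `k` ranges over `0,…,mn`). -/
def Dinf {m n : ℕ} (A : Fin m → Fin n → ℝ) : ℝ :=
  ⨆ k : Fin (m * n + 1),
    ⨅ I : { I : Finset (Fin m × Fin n) // I.card = k.1 },
      Real.sqrt (Log (k.1 : ℝ)) *
        ⨆ ij : { ij : Fin m × Fin n // ij ∉ I.1 }, |A ij.1.1 ij.1.2|

/-- `E max_{i,j} |a_{ij} g_{ij}|`. -/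
def EmaxGauss {m n : ℕ} (A : Fin m → Fin n → ℝ) : ℝ :=
  ∫ g : Fin m × Fin n → ℝ,
    (⨆ ij : Fin m × Fin n, |A ij.1 ij.2 * g ij|) ∂ stdGaussian (Fin m × Fin n)

instance isProbabilityMeasure_stdGaussian (ι : Type*) [Fintype ι] :
    IsProbabilityMeasure (_root_.stdGaussian ι) := by
  unfold _root_.stdGaussian; infer_instance

/-- Gaussian integration by parts on the line. -/
theorem integral_mul_gaussianReal_eq {h h' : ℝ → ℝ} {c c' : ℝ}
    (hd : ∀ x, HasDerivAt h (h' x) x) (hm : Measurable h')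
    (hb : ∀ x, |h x| ≤ c) (hb' : ∀ x, |h' x| ≤ c') :
    ∫ x, x * h x ∂gaussianReal 0 1 = ∫ x, h' x ∂gaussianReal 0 1 := by
  have hcont : Continuous h := continuous_iff_continuousAt.2 fun x => (hd x).continuousAt
  have hφd : ∀ x, HasDerivAt (gaussianPDFReal 0 1) (-x * gaussianPDFReal 0 1 x) x := by
    intro x
    unfold gaussianPDFReal
    have h1 : HasDerivAt (fun x : ℝ => -(x - 0) ^ 2 / (2 * ((1 : ℝ≥0) : ℝ))) (-x) x := by
      have := (((hasDerivAt_id x).sub_const 0).pow 2).neg.div_const (2 * ((1 : ℝ≥0) : ℝ))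
      refine (this.congr_deriv ?_)
      simp; ring
    refine ((h1.exp.const_mul _).congr_deriv ?_)
    ring
  have hφi : Integrable (gaussianPDFReal 0 1) := integrable_gaussianPDFReal 0 1
  have hxφ : Integrable fun x => x * gaussianPDFReal 0 1 x := by
    have h1 : Integrable (fun x : ℝ => x) (gaussianReal 0 1) :=
      (memLp_id_gaussianReal (μ := 0) (v := 1) 1).integrable (by simp)
    rw [gaussianReal_of_var_ne_zero _ one_ne_zero,
      integrable_withDensity_iff_integrable_smul' (measurable_gaussianPDF 0 1)
        (by simp [gaussianPDF_lt_top])] at h1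
    refine h1.congr (.of_forall fun x => ?_)
    simp [toReal_gaussianPDF, mul_comm]
  have key := integral_mul_deriv_eq_deriv_mul_of_integrable (A := ℝ) (u := h) (u' := h')
    (v := gaussianPDFReal 0 1) (v' := fun x => -x * gaussianPDFReal 0 1 x)
    (fun x _ => hd x) (fun x _ => hφd x) ?_ ?_ ?_
  · rw [integral_gaussianReal_eq_integral_smul one_ne_zero,
      integral_gaussianReal_eq_integral_smul one_ne_zero]
    simp only [smul_eq_mul]
    have e1 : ∫ x, gaussianPDFReal 0 1 x * (x * h x)
        = - ∫ x, h x * (-x * gaussianPDFReal 0 1 x) := by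
      rw [← integral_neg]; congr 1; ext x; ring
    rw [e1, key, neg_neg]
    congr 1; ext x; ring
  · refine (hxφ.neg.bdd_mul (c := c) hcont.aestronglyMeasurable
      (.of_forall fun x => hb x)).congr (.of_forall fun x => ?_)
    simp
  · exact hφi.bdd_mul (c := c') hm.aestronglyMeasurable (.of_forall fun x => hb' x)
  · exact hφi.bdd_mul (c := c) hcont.aestronglyMeasurable (.of_forall fun x => hb x)

theorem measurePreserving_update {κ : Type*} [Fintype κ] [DecidableEq κ] (k : κ) :
    MeasurePreserving (fun z : ℝ × (κ → ℝ) => Function.update z.2 k z.1)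
      ((gaussianReal 0 1).prod (_root_.stdGaussian κ)) (_root_.stdGaussian κ) := by
  have hmeas : Measurable (fun z : ℝ × (κ → ℝ) => Function.update z.2 k z.1) := by
    refine measurable_pi_iff.2 fun j => ?_
    by_cases hj : j = k
    · subst hj; simpa using measurable_fst
    · simp only [Function.update_of_ne hj]
      exact (measurable_pi_apply j).comp measurable_snd
  refine ⟨hmeas, ?_⟩
  refine (Measure.pi_eq fun s hs => ?_).symm
  rw [Measure.map_apply hmeas (MeasurableSet.univ_pi hs)]
  have : (fun z : ℝ × (κ → ℝ) => Function.update z.2 k z.1) ⁻¹' Set.univ.pi s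
      = s k ×ˢ Set.univ.pi (Function.update s k Set.univ) := by
    ext z
    simp only [Set.mem_preimage, Set.mem_univ_pi, Set.mem_prod]
    constructor
    · intro h
      refine ⟨by simpa using h k, fun j => ?_⟩
      by_cases hj : j = k
      · subst hj; simp
      · simpa [hj] using h j
    · rintro ⟨h1, h2⟩ j
      by_cases hj : j = k
      · subst hj; simpa using h1
      · simpa [hj] using h2 j
  rw [this, Measure.prod_prod, _root_.stdGaussian, Measure.pi_pi,
    ← Finset.mul_prod_erase Finset.univ _ (Finset.mem_univ k),
    ← Finset.mul_prod_erase Finset.univ (fun i => gaussianReal 0 1 (s i)) (Finset.mem_univ k)]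
  simp only [Function.update_self, measure_univ, one_mul]
  congr 1
  refine Finset.prod_congr rfl fun j hj => ?_
  rw [Function.update_of_ne (Finset.ne_of_mem_erase hj)]

theorem measurePreserving_comp_injective {κ ν : Type*} [Fintype κ] [Fintype ν] {e : κ → ν}
    (he : Function.Injective e) :
    MeasurePreserving (fun g : ν → ℝ => g ∘ e) (_root_.stdGaussian ν) (_root_.stdGaussian κ) := by
  classical
  have hmeas : Measurable (fun g : ν → ℝ => g ∘ e) :=
    measurable_pi_iff.2 fun j => measurable_pi_apply (e j)
  refine ⟨hmeas, ?_⟩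
  have h1 : iIndepFun (fun (i : ν) (g : ν → ℝ) => g i) (_root_.stdGaussian ν) :=
    iIndepFun_pi (X := fun _ => id) (fun _ => aemeasurable_id)
  have h2 := h1.precomp he
  rw [iIndepFun_iff_map_fun_eq_pi_map
    fun i => (measurable_pi_apply (e i)).aemeasurable] at h2
  refine h2.trans ?_
  unfold _root_.stdGaussian
  congr 1; ext1 i
  exact (measurePreserving_eval (fun _ : ν => gaussianReal 0 1) (e i)).map_eq

theorem integrable_eval_stdGaussian {κ : Type*} [Fintype κ] (k : κ) :
    Integrable (fun g : κ → ℝ => g k) (_root_.stdGaussian κ) :=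
  integrable_comp_eval (μ := fun _ : κ => gaussianReal 0 1) (i := k) (f := fun x : ℝ => x)
    ((memLp_id_gaussianReal (μ := 0) (v := 1) 1).integrable (by simp))

/-- Gaussian integration by parts in one coordinate of a standard Gaussian vector. -/
theorem integral_eval_mul_stdGaussian {κ : Type*} [Fintype κ] [DecidableEq κ] (k : κ)
    {f f' : (κ → ℝ) → ℝ} {c c' : ℝ} (hf : Measurable f) (hf' : Measurable f')
    (hd : ∀ g x, HasDerivAt (fun x => f (Function.update g k x)) (f' (Function.update g k x)) x)
    (hb : ∀ g, |f g| ≤ c) (hb' : ∀ g, |f' g| ≤ c') :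
    ∫ g, g k * f g ∂_root_.stdGaussian κ = ∫ g, f' g ∂_root_.stdGaussian κ := by
  have hp := measurePreserving_update k
  have i1 : Integrable (fun g : κ → ℝ => g k * f g) (_root_.stdGaussian κ) :=
    (integrable_eval_stdGaussian k).mul_bdd (c := c) hf.aestronglyMeasurable
      (.of_forall fun x => hb x)
  have i2 : Integrable f' (_root_.stdGaussian κ) :=
    Integrable.of_bound hf'.aestronglyMeasurable c' (.of_forall fun x => hb' x)
  have e1 : ∀ {F : (κ → ℝ) → ℝ}, Integrable F (_root_.stdGaussian κ) →
      ∫ g, F g ∂_root_.stdGaussian κ =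
      ∫ g, ∫ x, F (Function.update g k x) ∂gaussianReal 0 1 ∂_root_.stdGaussian κ := by
    intro F hF
    conv_lhs => rw [← hp.map_eq]
    rw [integral_map hp.measurable.aemeasurable (by rw [hp.map_eq]; exact hF.1)]
    exact integral_prod_symm _ (hp.integrable_comp_of_integrable hF)
  rw [e1 i1, e1 i2]
  congr 1; ext g
  simp only [Function.update_self]
  refine integral_mul_gaussianReal_eq (c := c) (c' := c') (hd g) ?_ (fun x => hb _) fun x => hb' _
  exact hf'.comp (measurable_update g)

/-- The softmax weights of a finite real family. -/
def softmax {T : Type*} [Fintype T] (u : T → ℝ) (a : T) : ℝ :=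
  Real.exp (u a) / ∑ b, Real.exp (u b)

section Softmax

variable {T : Type*} [Fintype T]

theorem measurable_softmax {α : Type*} [MeasurableSpace α] {u : T → α → ℝ}
    (h : ∀ a, Measurable (u a)) (a : T) : Measurable fun x => softmax (fun a => u a x) a := by
  unfold softmax
  exact (h a).exp.div (Finset.measurable_sum _ fun b _ => (h b).exp)

variable [Nonempty T]

theorem sum_exp_pos (u : T → ℝ) : 0 < ∑ b, Real.exp (u b) :=
  Finset.sum_pos (fun _ _ => Real.exp_pos _) Finset.univ_nonempty

theorem softmax_nonneg (u : T → ℝ) (a : T) : 0 ≤ softmax u a :=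
  div_nonneg (Real.exp_pos _).le (sum_exp_pos u).le

theorem sum_softmax (u : T → ℝ) : ∑ a, softmax u a = 1 := by
  simp only [softmax, ← Finset.sum_div]
  exact div_self (sum_exp_pos u).ne'

theorem softmax_le_one (u : T → ℝ) (a : T) : softmax u a ≤ 1 := by
  rw [← sum_softmax u]
  exact Finset.single_le_sum (fun b _ => softmax_nonneg u b) (Finset.mem_univ a)

theorem hasDerivAt_log_sum_exp {u : T → ℝ → ℝ} {u' : T → ℝ} {x : ℝ}
    (h : ∀ a, HasDerivAt (u a) (u' a) x) :
    HasDerivAt (fun x => Real.log (∑ a, Real.exp (u a x)))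
      (∑ a, softmax (fun a => u a x) a * u' a) x := by
  have h1 : HasDerivAt (fun x => ∑ a, Real.exp (u a x)) (∑ a, Real.exp (u a x) * u' a) x :=
    HasDerivAt.fun_sum fun a _ => (h a).exp
  refine (h1.log (sum_exp_pos _).ne').congr_deriv ?_
  rw [Finset.sum_div]
  exact Finset.sum_congr rfl fun a _ => by simp only [softmax]; ring

theorem hasDerivAt_softmax {u : T → ℝ → ℝ} {u' : T → ℝ} {x : ℝ}
    (h : ∀ a, HasDerivAt (u a) (u' a) x) (a : T) :
    HasDerivAt (fun x => softmax (fun a => u a x) a)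
      (softmax (fun a => u a x) a * (u' a - ∑ b, softmax (fun a => u a x) b * u' b)) x := by
  have h1 : HasDerivAt (fun x => ∑ a, Real.exp (u a x)) (∑ a, Real.exp (u a x) * u' a) x :=
    HasDerivAt.fun_sum fun a _ => (h a).exp
  refine ((h a).exp.div h1 (sum_exp_pos _).ne').congr_deriv ?_
  have e : ∑ b, softmax (fun a => u a x) b * u' b
      = (∑ b, Real.exp (u b x) * u' b) / ∑ b, Real.exp (u b x) := by
    rw [Finset.sum_div]
    exact Finset.sum_congr rfl fun a _ => by simp only [softmax]; ring
  rw [e]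
  have := (sum_exp_pos fun a => u a x).ne'
  simp only [softmax]
  field_simp

theorem le_log_sum_exp (u : T → ℝ) (a : T) : u a ≤ Real.log (∑ b, Real.exp (u b)) := by
  rw [Real.le_log_iff_exp_le (sum_exp_pos u)]
  exact Finset.single_le_sum (f := fun b => Real.exp (u b))
    (fun b _ => (Real.exp_pos _).le) (Finset.mem_univ a)

theorem log_sum_exp_le {u : T → ℝ} {M : ℝ} (h : ∀ a, u a ≤ M) :
    Real.log (∑ b, Real.exp (u b)) ≤ M + Real.log (Fintype.card T) := by
  have h1 : ∑ b, Real.exp (u b) ≤ Fintype.card T * Real.exp M := by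
    have := Finset.sum_le_card_nsmul Finset.univ (fun b => Real.exp (u b)) (Real.exp M)
      fun b _ => Real.exp_le_exp.2 (h b)
    simpa using this
  have hT : (0 : ℝ) < Fintype.card T := by exact_mod_cast Fintype.card_pos
  calc Real.log (∑ b, Real.exp (u b)) ≤ Real.log (Fintype.card T * Real.exp M) :=
        Real.log_le_log (sum_exp_pos u) h1
    _ = M + Real.log (Fintype.card T) := by
        rw [Real.log_mul hT.ne' (Real.exp_pos _).ne', Real.log_exp, add_comm]

theorem abs_log_sum_exp_le (u : T → ℝ) :
    |Real.log (∑ b, Real.exp (u b))| ≤ ∑ a, |u a| + Real.log (Fintype.card T) := by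
  have hs : ∀ a, |u a| ≤ ∑ a, |u a| := fun a =>
    Finset.single_le_sum (f := fun b => |u b|) (fun b _ => abs_nonneg _) (Finset.mem_univ a)
  have hc : 0 ≤ Real.log (Fintype.card T) := Real.log_natCast_nonneg _
  obtain ⟨a⟩ := ‹Nonempty T›
  rw [abs_le]
  constructor
  · have := (abs_le.1 (hs a)).1
    linarith [le_log_sum_exp u a]
  · exact log_sum_exp_le fun a => (le_abs_self _).trans (hs a)

end Softmax

section Comparison

variable {T : Type*} [Fintype T] {ν : Type*} [Fintype ν]

/-- Algebraic core of the Sudakov–Fernique inequality: the derivative along the interpolation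
is nonnegative. -/
theorem sum_softmax_increment_nonneg {p : T → ℝ} (hp : ∀ a, 0 ≤ p a) (hp1 : ∑ a, p a = 1)
    (z w : T → ν → ℝ) (hsymm : ∀ a b, ∑ v, w a v * z b v = ∑ v, w b v * z a v)
    (h : ∀ a b, 0 ≤ ∑ v, (w a v - w b v) * (z a v - z b v)) :
    0 ≤ ∑ a, p a * ∑ v, w a v * (z a v - ∑ b, p b * z b v) := by
  set K : T → T → ℝ := fun a b => ∑ v, w a v * z b v with hK
  have hinc : ∀ a b, 0 ≤ K a a + K b b - 2 * K a b := by
    intro a b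
    have : ∑ v, (w a v - w b v) * (z a v - z b v) = K a a + K b b - K a b - K b a := by
      simp only [hK, ← Finset.sum_add_distrib, ← Finset.sum_sub_distrib]
      exact Finset.sum_congr rfl fun v _ => by ring
    have h1 := h a b
    have h2 : K a b = K b a := hsymm a b
    linarith
  have e : ∀ a, ∑ v, w a v * (z a v - ∑ b, p b * z b v) = K a a - ∑ b, p b * K a b := by
    intro a
    simp only [mul_sub, Finset.sum_sub_distrib, hK, Finset.mul_sum]
    congr 1
    rw [Finset.sum_comm]
    exact Finset.sum_congr rfl fun v _ => Finset.sum_congr rfl fun b _ => by ring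
  have hfin : ∑ a, p a * (K a a - ∑ b, p b * K a b)
      = 1 / 2 * ∑ a, ∑ b, p a * p b * (K a a + K b b - 2 * K a b) := by
    have h1 : ∑ a, ∑ b, p a * p b * K a a = ∑ a, p a * K a a := by
      refine Finset.sum_congr rfl fun a _ => ?_
      calc ∑ b, p a * p b * K a a = (p a * K a a) * ∑ b, p b := by
            rw [Finset.mul_sum]; exact Finset.sum_congr rfl fun b _ => by ring
        _ = _ := by rw [hp1, mul_one]
    have h2 : ∑ a, ∑ b, p a * p b * K b b = ∑ a, p a * K a a := by
      rw [Finset.sum_comm, ← h1]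
      exact Finset.sum_congr rfl fun v _ => Finset.sum_congr rfl fun b _ => by ring
    have h3 : ∑ a, ∑ b, p a * p b * (K a a + K b b - 2 * K a b)
        = ∑ a, ∑ b, p a * p b * K a a + ∑ a, ∑ b, p a * p b * K b b
          - 2 * ∑ a, ∑ b, p a * p b * K a b := by
      simp only [Finset.mul_sum, ← Finset.sum_add_distrib, ← Finset.sum_sub_distrib]
      exact Finset.sum_congr rfl fun v _ => Finset.sum_congr rfl fun b _ => by ring
    rw [h3, h1, h2]
    simp only [mul_sub, Finset.sum_sub_distrib, Finset.mul_sum, mul_assoc]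
    have h4 : ∀ x y : ℝ, x - y = 1 / 2 * (x + x) - y := by intros; ring
    rw [h4]
    congr 1
    simp
  simp only [e, hfin]
  refine mul_nonneg (by norm_num) (Finset.sum_nonneg fun a _ => Finset.sum_nonneg fun b _ => ?_)
  exact mul_nonneg (mul_nonneg (hp a) (hp b)) (hinc a b)

variable [Nonempty T]

/-- Multivariate Gaussian integration by parts for softmax weights of a linear family. -/
theorem integral_softmax_mul (z w : T → ν → ℝ) :
    ∫ g, ∑ a, softmax (fun a => ∑ v, z a v * g v) a * ∑ v, w a v * g v ∂_root_.stdGaussian ν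
    = ∫ g, ∑ a, softmax (fun a => ∑ v, z a v * g v) a *
        ∑ v, w a v * (z a v - ∑ b, softmax (fun a => ∑ v, z a v * g v) b * z b v)
        ∂_root_.stdGaussian ν := by
  classical
  set p : (ν → ℝ) → T → ℝ := fun g => softmax (fun a => ∑ v, z a v * g v) with hp
  have hm : ∀ a, Measurable fun g => p g a := fun a =>
    measurable_softmax (fun a => Finset.measurable_sum _ fun v _ =>
      (measurable_pi_apply v).const_mul _) a
  have hb : ∀ g a, |p g a| ≤ 1 := fun g a => by
    rw [abs_of_nonneg (softmax_nonneg _ _)]; exact softmax_le_one _ _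
  have hm' : ∀ a v, Measurable fun g => p g a * (z a v - ∑ b, p g b * z b v) := fun a v =>
    (hm a).mul ((Finset.measurable_sum _ fun b _ => (hm b).mul_const _).const_sub _)
  have hb' : ∀ a v g, |p g a * (z a v - ∑ b, p g b * z b v)| ≤ 1 * (|z a v| + ∑ b, |z b v|) := by
    intro a v g
    rw [abs_mul]
    gcongr
    · exact hb g a
    · refine (abs_sub _ _).trans (add_le_add le_rfl ?_)
      refine (Finset.abs_sum_le_sum_abs _ _).trans (Finset.sum_le_sum fun b _ => ?_)
      rw [abs_mul]
      exact mul_le_of_le_one_left (abs_nonneg _) (hb g b)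
  have key : ∀ a v, ∫ g, g v * p g a ∂_root_.stdGaussian ν
      = ∫ g, p g a * (z a v - ∑ b, p g b * z b v) ∂_root_.stdGaussian ν := by
    intro a v
    refine integral_eval_mul_stdGaussian v (hm a) (hm' a v) (fun g x => ?_)
      (fun g => hb g a) (hb' a v)
    refine hasDerivAt_softmax (u := fun a x => ∑ v', z a v' * Function.update g v x v')
      (u' := fun a => z a v) (fun a => ?_) a
    have : HasDerivAt (fun x => ∑ v', z a v' * Function.update g v x v')
        (∑ v', z a v' * (if v' = v then 1 else 0)) x := by
      refine HasDerivAt.fun_sum fun v' _ => HasDerivAt.const_mul _ ?_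
      by_cases h : v' = v
      · subst h; simpa using hasDerivAt_id' x
      · simpa [h] using hasDerivAt_const x (g v')
    simpa using this
  have i1 : ∀ a v, Integrable (fun g => g v * p g a) (_root_.stdGaussian ν) := fun a v =>
    (integrable_eval_stdGaussian v).mul_bdd (c := 1) (hm a).aestronglyMeasurable
      (.of_forall fun x => hb x a)
  have i2 : ∀ a v, Integrable (fun g => p g a * (z a v - ∑ b, p g b * z b v))
      (_root_.stdGaussian ν) := fun a v =>
    Integrable.of_bound (hm' a v).aestronglyMeasurable _ (.of_forall fun x => hb' a v x)
  have l : ∀ g, ∑ a, p g a * ∑ v, w a v * g v = ∑ a, ∑ v, w a v * (g v * p g a) := fun g =>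
    Finset.sum_congr rfl fun a _ => by
      rw [Finset.mul_sum]; exact Finset.sum_congr rfl fun v _ => by ring
  have r : ∀ g, ∑ a, p g a * ∑ v, w a v * (z a v - ∑ b, p g b * z b v)
      = ∑ a, ∑ v, w a v * (p g a * (z a v - ∑ b, p g b * z b v)) := fun g =>
    Finset.sum_congr rfl fun a _ => by
      rw [Finset.mul_sum]; exact Finset.sum_congr rfl fun v _ => by ring
  refine (integral_congr_ae (.of_forall l)).trans
    (Eq.trans ?_ (integral_congr_ae (.of_forall r)).symm)
  rw [integral_finsetSum _ fun a _ => integrable_finsetSum _ fun v _ => (i1 a v).const_mul _,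
    integral_finsetSum _ fun a _ => integrable_finsetSum _ fun v _ => (i2 a v).const_mul _]
  refine Finset.sum_congr rfl fun a _ => ?_
  rw [integral_finsetSum _ fun v _ => (i1 a v).const_mul _,
    integral_finsetSum _ fun v _ => (i2 a v).const_mul _]
  refine Finset.sum_congr rfl fun v _ => ?_
  rw [integral_const_mul, integral_const_mul, key]

theorem integrable_linear (c : ν → ℝ) :
    Integrable (fun g => ∑ v, c v * g v) (_root_.stdGaussian ν) :=
  integrable_finsetSum _ fun v _ => (integrable_eval_stdGaussian v).const_mul _

theorem integrable_log_sum_exp (z : T → ν → ℝ) :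
    Integrable (fun g => Real.log (∑ a, Real.exp (∑ v, z a v * g v))) (_root_.stdGaussian ν) := by
  refine Integrable.mono' (g := fun g => ∑ a, |∑ v, z a v * g v| + Real.log (Fintype.card T))
    ?_ ?_ (.of_forall fun g => abs_log_sum_exp_le _)
  · exact (integrable_finsetSum _ fun a _ => (integrable_linear (z a)).abs).add
      (integrable_const _)
  · exact (Finset.measurable_sum _ fun a _ => (Finset.measurable_sum _ fun v _ =>
      (measurable_pi_apply v).const_mul _).exp).log.aestronglyMeasurable

end Comparison

section SudakovFernique

variable {T : Type*} [Fintype T] [Nonempty T] {κ ν : Type*} [Fintype κ] [Fintype ν]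

/-- Sudakov–Fernique inequality for the log-sum-exp functional. -/
theorem integral_log_sum_exp_le (x : T → κ → ℝ) (y : T → ν → ℝ)
    (h : ∀ a b, ∑ k, (x a k - x b k) ^ 2 ≤ ∑ l, (y a l - y b l) ^ 2) :
    ∫ g, Real.log (∑ a, Real.exp (∑ k, x a k * g k)) ∂_root_.stdGaussian κ ≤
      ∫ g, Real.log (∑ a, Real.exp (∑ l, y a l * g l)) ∂_root_.stdGaussian ν := by
  set z : ℝ → T → κ ⊕ ν → ℝ := fun θ a =>
    Sum.elim (fun k => Real.cos θ * x a k) (fun l => Real.sin θ * y a l) with hz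
  set w : ℝ → T → κ ⊕ ν → ℝ := fun θ a =>
    Sum.elim (fun k => -Real.sin θ * x a k) (fun l => Real.cos θ * y a l) with hw
  set Φ : ℝ → ℝ := fun θ =>
    ∫ g, Real.log (∑ a, Real.exp (∑ v, z θ a v * g v)) ∂_root_.stdGaussian (κ ⊕ ν) with hΦ
  have hwb : ∀ θ a v, |w θ a v| ≤ |Sum.elim (x a) (y a) v| := by
    rintro θ a (k | l)
    · simp only [hw, Sum.elim_inl, abs_mul, abs_neg]
      exact mul_le_of_le_one_left (abs_nonneg _) (Real.abs_sin_le_one θ)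
    · simp only [hw, Sum.elim_inr, abs_mul]
      exact mul_le_of_le_one_left (abs_nonneg _) (Real.abs_cos_le_one θ)
  have hmeas : ∀ c : κ ⊕ ν → ℝ, Measurable fun g : κ ⊕ ν → ℝ => ∑ v, c v * g v := fun c =>
    Finset.measurable_sum _ fun v _ => (measurable_pi_apply v).const_mul _
  have hder : ∀ θ, HasDerivAt Φ (∫ g, ∑ a, softmax (fun a => ∑ v, z θ a v * g v) a *
      ∑ v, w θ a v * g v ∂_root_.stdGaussian (κ ⊕ ν)) θ := by
    intro θ
    refine (hasDerivAt_integral_of_dominated_loc_of_deriv_le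
      (F' := fun θ g => ∑ a, softmax (fun a => ∑ v, z θ a v * g v) a * ∑ v, w θ a v * g v)
      (bound := fun g => ∑ a, ∑ v, |Sum.elim (x a) (y a) v| * |g v|)
      Filter.univ_mem (.of_forall fun t => (integrable_log_sum_exp (z t)).1)
      (integrable_log_sum_exp (z θ)) ?_ ?_ ?_ ?_).2
    · exact (Finset.measurable_sum _ fun a _ =>
        (measurable_softmax (fun a => hmeas (z θ a)) a).mul (hmeas _)).aestronglyMeasurable
    · refine .of_forall fun g t _ => ?_
      rw [Real.norm_eq_abs]
      refine (Finset.abs_sum_le_sum_abs _ _).trans (Finset.sum_le_sum fun a _ => ?_)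
      rw [abs_mul, abs_of_nonneg (softmax_nonneg _ _)]
      refine (mul_le_of_le_one_left (abs_nonneg _) (softmax_le_one _ _)).trans ?_
      refine (Finset.abs_sum_le_sum_abs _ _).trans (Finset.sum_le_sum fun v _ => ?_)
      rw [abs_mul]
      exact mul_le_mul_of_nonneg_right (hwb t a v) (abs_nonneg _)
    · exact integrable_finsetSum _ fun a _ => integrable_finsetSum _ fun v _ =>
        (integrable_eval_stdGaussian v).abs.const_mul _
    · refine .of_forall fun g t _ => hasDerivAt_log_sum_exp fun a => ?_
      refine HasDerivAt.fun_sum fun v _ => HasDerivAt.mul_const ?_ _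
      rcases v with k | l
      · simpa [hz, hw] using (Real.hasDerivAt_cos t).mul_const (x a k)
      · simpa [hz, hw] using (Real.hasDerivAt_sin t).mul_const (y a l)
  have hmono : MonotoneOn Φ (Set.Icc 0 (Real.pi / 2)) := by
    refine monotoneOn_of_deriv_nonneg (convex_Icc _ _)
      (fun θ _ => (hder θ).continuousAt.continuousWithinAt)
      (fun θ _ => (hder θ).differentiableAt.differentiableWithinAt) fun θ hθ => ?_
    rw [interior_Icc] at hθ
    have hsc : 0 ≤ Real.sin θ * Real.cos θ :=
      mul_nonneg (Real.sin_nonneg_of_nonneg_of_le_pi hθ.1.le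
        (by linarith [hθ.2, Real.pi_pos])) (Real.cos_nonneg_of_neg_pi_div_two_le_of_le
        (by linarith [hθ.1, Real.pi_pos]) hθ.2.le)
    rw [(hder θ).deriv, integral_softmax_mul]
    refine integral_nonneg fun g => sum_softmax_increment_nonneg (softmax_nonneg _)
      (sum_softmax _) _ _ (fun a b => ?_) fun a b => ?_
    · simp only [hz, hw, Fintype.sum_sum_type, Sum.elim_inl, Sum.elim_inr]
      congr 1 <;> exact Finset.sum_congr rfl fun v _ => by ring
    · have e : ∑ v, (w θ a v - w θ b v) * (z θ a v - z θ b v) = Real.sin θ * Real.cos θ *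
          (∑ l, (y a l - y b l) ^ 2 - ∑ k, (x a k - x b k) ^ 2) := by
        simp only [hz, hw, Fintype.sum_sum_type, Sum.elim_inl, Sum.elim_inr, mul_sub,
          Finset.mul_sum]
        rw [sub_eq_neg_add, ← Finset.sum_neg_distrib]
        congr 1 <;> exact Finset.sum_congr rfl fun v _ => by ring
      rw [e]
      exact mul_nonneg hsc (sub_nonneg.2 (h a b))
  have hfin := hmono (Set.left_mem_Icc.2 Real.pi_div_two_pos.le)
    (Set.right_mem_Icc.2 Real.pi_div_two_pos.le) Real.pi_div_two_pos.le
  have e0 : Φ 0 = ∫ g, Real.log (∑ a, Real.exp (∑ k, x a k * g k)) ∂_root_.stdGaussian κ := by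
    have hp := measurePreserving_comp_injective (κ := κ) (ν := κ ⊕ ν) Sum.inl_injective
    conv_rhs => rw [← hp.map_eq]
    rw [integral_map hp.measurable.aemeasurable
      (by rw [hp.map_eq]; exact (integrable_log_sum_exp x).1)]
    simp [hΦ, hz]
  have e1 : Φ (Real.pi / 2)
      = ∫ g, Real.log (∑ a, Real.exp (∑ k, y a k * g k)) ∂_root_.stdGaussian ν := by
    have hp := measurePreserving_comp_injective (κ := ν) (ν := κ ⊕ ν) Sum.inr_injective
    conv_rhs => rw [← hp.map_eq]
    rw [integral_map hp.measurable.aemeasurable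
      (by rw [hp.map_eq]; exact (integrable_log_sum_exp y).1)]
    simp [hΦ, hz]
  rwa [e0, e1] at hfin

/-- Sudakov–Fernique inequality, with any integrable majorant `Ψ` of the dominating process. -/
theorem integral_le_of_sudakovFernique (x : T → κ → ℝ) (y : T → ν → ℝ)
    (h : ∀ a b, ∑ k, (x a k - x b k) ^ 2 ≤ ∑ l, (y a l - y b l) ^ 2)
    {F : (κ → ℝ) → ℝ} {Ψ : (ν → ℝ) → ℝ} (hF : Integrable F (_root_.stdGaussian κ))
    (hΨ : Integrable Ψ (_root_.stdGaussian ν))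
    (hFx : ∀ g, ∃ a, F g ≤ ∑ k, x a k * g k) (hyΨ : ∀ g a, ∑ l, y a l * g l ≤ Ψ g) :
    ∫ g, F g ∂_root_.stdGaussian κ ≤ ∫ g, Ψ g ∂_root_.stdGaussian ν := by
  have key : ∀ β : ℝ, 0 < β → β * ∫ g, F g ∂_root_.stdGaussian κ ≤
      β * ∫ g, Ψ g ∂_root_.stdGaussian ν + Real.log (Fintype.card T) := by
    intro β hβ
    have hx : ∀ a (g : κ → ℝ), ∑ k, (β * x a k) * g k = β * ∑ k, x a k * g k := fun a g => by
      rw [Finset.mul_sum]; exact Finset.sum_congr rfl fun k _ => by ring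
    have hy : ∀ a (g : ν → ℝ), ∑ k, (β * y a k) * g k = β * ∑ k, y a k * g k := fun a g => by
      rw [Finset.mul_sum]; exact Finset.sum_congr rfl fun k _ => by ring
    have h1 := integral_log_sum_exp_le (fun a k => β * x a k) (fun a k => β * y a k)
      (fun a b => by
        simp only [← mul_sub, mul_pow, ← Finset.mul_sum]
        exact mul_le_mul_of_nonneg_left (h a b) (sq_nonneg β))
    calc β * ∫ g, F g ∂_root_.stdGaussian κ = ∫ g, β * F g ∂_root_.stdGaussian κ :=
          (integral_const_mul _ _).symm
      _ ≤ _ := by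
          refine integral_mono (hF.const_mul _) (integrable_log_sum_exp _) fun g => ?_
          obtain ⟨a, ha⟩ := hFx g
          refine le_trans ?_ (le_log_sum_exp _ a)
          rw [hx]
          exact mul_le_mul_of_nonneg_left ha hβ.le
      _ ≤ _ := h1
      _ ≤ ∫ g, (β * Ψ g + Real.log (Fintype.card T)) ∂_root_.stdGaussian ν := by
          refine integral_mono (integrable_log_sum_exp _)
            ((hΨ.const_mul _).add (integrable_const _)) fun g => ?_
          refine log_sum_exp_le fun a => ?_
          rw [hy]
          exact mul_le_mul_of_nonneg_left (hyΨ g a) hβ.le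
      _ = _ := by
          rw [integral_add (hΨ.const_mul _) (integrable_const _), integral_const_mul]
          simp
  set c := Real.log (Fintype.card T) with hc
  have hc0 : 0 ≤ c := Real.log_natCast_nonneg _
  refine le_of_forall_pos_le_add fun ε hε => ?_
  have h1 := key ((c + 1) / ε) (by positivity)
  have h2 : c ≤ (c + 1) / ε * ε := by rw [div_mul_cancel₀ _ hε.ne']; linarith
  refine le_of_mul_le_mul_left (?_ : (c + 1) / ε * _ ≤ (c + 1) / ε * _) (by positivity)
  rw [mul_add]
  linarith

end SudakovFernique

section ProductProcess

/-- Weighted Euclidean norms `√(∑ j, b i j * t j ^ 2)` of the rows of `b`. -/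
def rowNorm {ι κ : Type*} [Fintype κ] (b : ι → κ → ℝ) (t : κ → ℝ) (i : ι) : ℝ :=
  Real.sqrt (∑ j, b i j * t j ^ 2)

/-- Lower bound for `-P * σ * σ'` in terms of the entries defining `σ` and `σ'`. -/
def crossBound (P t t' : ℝ) : ℝ :=
  if 0 ≤ P then -P * (t ^ 2 + t' ^ 2) / 2 else -P * |t * t'|

theorem half_mul_le_crossBound (s s' t t' : ℝ) :
    (s ^ 2 - s' ^ 2) * (t ^ 2 - t' ^ 2) / 2 ≤
      s ^ 2 * t ^ 2 + s' ^ 2 * t' ^ 2 + 2 * ((s * s') * (t * t'))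
        + 2 * crossBound (s * s') t t' + 2 * crossBound (t * t') s s' := by
  unfold crossBound
  have hP := two_mul_le_add_sq s s'
  have hQ := two_mul_le_add_sq t t'
  split_ifs with h1 h2 h2
  · nlinarith [mul_nonneg (sq_nonneg (s - s')) (sq_nonneg (t - t'))]
  · rw [abs_of_nonneg h1]
    nlinarith [mul_nonneg (sub_nonneg.2 hP) (add_nonneg (sq_nonneg t) (sq_nonneg t'))]
  · rw [abs_of_nonneg h2]
    nlinarith [mul_nonneg (sub_nonneg.2 hQ) (add_nonneg (sq_nonneg s) (sq_nonneg s'))]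
  · push Not at h1 h2
    rw [abs_of_neg h1, abs_of_neg h2]
    nlinarith [mul_pos_of_neg_of_neg h1 h2, mul_nonneg (add_nonneg (sq_nonneg s) (sq_nonneg s'))
      (add_nonneg (sq_nonneg t) (sq_nonneg t'))]

variable {ι κ : Type*} [Fintype κ]

theorem rowNorm_sq {b : ι → κ → ℝ} (hb : ∀ i j, 0 ≤ b i j) (t : κ → ℝ) (i : ι) :
    rowNorm b t i ^ 2 = ∑ j, b i j * t j ^ 2 :=
  Real.sq_sqrt (Finset.sum_nonneg fun j _ => mul_nonneg (hb i j) (sq_nonneg _))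

theorem sum_crossBound_le {b : ι → κ → ℝ} (hb : ∀ i j, 0 ≤ b i j) (t t' : κ → ℝ) (i : ι) (P : ℝ) :
    ∑ j, b i j * crossBound P (t j) (t' j) ≤ -P * (rowNorm b t i * rowNorm b t' i) := by
  unfold crossBound
  split_ifs with h
  · have h1 := two_mul_le_add_sq (rowNorm b t i) (rowNorm b t' i)
    rw [rowNorm_sq hb, rowNorm_sq hb] at h1
    have e : ∑ j, b i j * (-P * (t j ^ 2 + t' j ^ 2) / 2)
        = -P * ((∑ j, b i j * t j ^ 2 + ∑ j, b i j * t' j ^ 2) / 2) := by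
      rw [← Finset.sum_add_distrib, Finset.sum_div, Finset.mul_sum]
      exact Finset.sum_congr rfl fun j _ => by ring
    rw [e]
    exact mul_le_mul_of_nonpos_left (by linarith) (by linarith)
  · have e : ∑ j, b i j * (-P * |t j * t' j|)
        = -P * ∑ j, (Real.sqrt (b i j) * |t j|) * (Real.sqrt (b i j) * |t' j|) := by
      rw [Finset.mul_sum]
      refine Finset.sum_congr rfl fun j _ => ?_
      rw [abs_mul]
      linear_combination (-P * |t j| * |t' j|) * (Real.mul_self_sqrt (hb i j)).symm
    rw [e]
    refine mul_le_mul_of_nonneg_left ?_ (by linarith)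
    refine (Real.sum_mul_le_sqrt_mul_sqrt _ _ _).trans (le_of_eq ?_)
    simp only [rowNorm, mul_pow, sq_abs, Real.sq_sqrt (hb i _)]

variable [Fintype ι]

theorem increment_le {b : ι → κ → ℝ} (hb : ∀ i j, 0 ≤ b i j) (s s' : ι → ℝ) (t t' : κ → ℝ) :
    ∑ i, ∑ j, b i j * (s i * t j - s' i * t' j) ^ 2 ≤
      ∑ i, (rowNorm b t i * s i - rowNorm b t' i * s' i) ^ 2
      + ∑ j, (rowNorm (fun j i => b i j) s j * t j - rowNorm (fun j i => b i j) s' j * t' j) ^ 2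
      + 1 / 2 * |∑ i, ∑ j, b i j * ((s i ^ 2 - s' i ^ 2) * (t j ^ 2 - t' j ^ 2))| := by
  have row : ∀ i, ∑ j, b i j * (s i ^ 2 * t j ^ 2 + s' i ^ 2 * t' j ^ 2
      + 2 * crossBound (s i * s' i) (t j) (t' j))
      ≤ (rowNorm b t i * s i - rowNorm b t' i * s' i) ^ 2 := by
    intro i
    have h1 := sum_crossBound_le hb t t' i (s i * s' i)
    have e : ∑ j, b i j * (s i ^ 2 * t j ^ 2 + s' i ^ 2 * t' j ^ 2
        + 2 * crossBound (s i * s' i) (t j) (t' j))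
        = s i ^ 2 * rowNorm b t i ^ 2 + s' i ^ 2 * rowNorm b t' i ^ 2
          + 2 * ∑ j, b i j * crossBound (s i * s' i) (t j) (t' j) := by
      rw [rowNorm_sq hb, rowNorm_sq hb]
      simp only [Finset.mul_sum, ← Finset.sum_add_distrib]
      exact Finset.sum_congr rfl fun j _ => by ring
    rw [e]
    nlinarith
  have col : ∀ j, ∑ i, b i j * (s i ^ 2 * t j ^ 2 + s' i ^ 2 * t' j ^ 2
      + 2 * crossBound (t j * t' j) (s i) (s' i))
      ≤ (rowNorm (fun j i => b i j) s j * t j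
        - rowNorm (fun j i => b i j) s' j * t' j) ^ 2 := by
    intro j
    have hb' : ∀ j i, 0 ≤ (fun j i => b i j) j i := fun j i => hb i j
    have h1 := sum_crossBound_le hb' s s' j (t j * t' j)
    have e : ∑ i, b i j * (s i ^ 2 * t j ^ 2 + s' i ^ 2 * t' j ^ 2
        + 2 * crossBound (t j * t' j) (s i) (s' i))
        = t j ^ 2 * rowNorm (fun j i => b i j) s j ^ 2
          + t' j ^ 2 * rowNorm (fun j i => b i j) s' j ^ 2
          + 2 * ∑ i, b i j * crossBound (t j * t' j) (s i) (s' i) := by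
      rw [rowNorm_sq hb', rowNorm_sq hb']
      simp only [Finset.mul_sum, ← Finset.sum_add_distrib]
      exact Finset.sum_congr rfl fun j _ => by ring
    rw [e]
    nlinarith
  have h1 := Finset.sum_le_sum fun i (_ : i ∈ Finset.univ) => row i
  have h2 := Finset.sum_le_sum fun j (_ : j ∈ Finset.univ) => col j
  rw [Finset.sum_comm] at h2
  have h3 := neg_abs_le (∑ i, ∑ j, b i j * ((s i ^ 2 - s' i ^ 2) * (t j ^ 2 - t' j ^ 2)))
  have h4 : ∑ i, ∑ j, b i j * (s i * t j - s' i * t' j) ^ 2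
      + 1 / 2 * ∑ i, ∑ j, b i j * ((s i ^ 2 - s' i ^ 2) * (t j ^ 2 - t' j ^ 2))
      ≤ ∑ i, ∑ j, b i j * (s i ^ 2 * t j ^ 2 + s' i ^ 2 * t' j ^ 2
        + 2 * crossBound (s i * s' i) (t j) (t' j))
      + ∑ i, ∑ j, b i j * (s i ^ 2 * t j ^ 2 + s' i ^ 2 * t' j ^ 2
        + 2 * crossBound (t j * t' j) (s i) (s' i)) := by
    simp only [Finset.mul_sum, ← Finset.sum_add_distrib]
    refine Finset.sum_le_sum fun i _ => Finset.sum_le_sum fun j _ => ?_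
    have := mul_le_mul_of_nonneg_left (half_mul_le_crossBound (s i) (s' i) (t j) (t' j)) (hb i j)
    linarith
  linarith

theorem integral_comp_measurePreserving {α β : Type*} [MeasurableSpace α] [MeasurableSpace β]
    {ν : Measure α} {ρ : Measure β} {f : α → β} (hf : MeasurePreserving f ν ρ) {Ψ : β → ℝ}
    (hΨ : Integrable Ψ ρ) : ∫ x, Ψ (f x) ∂ν = ∫ y, Ψ y ∂ρ := by
  conv_rhs => rw [← hf.map_eq]
  rw [integral_map hf.measurable.aemeasurable (by rw [hf.map_eq]; exact hΨ.1)]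

/-- Comparison of the bilinear Gaussian process `∑ a i j g i j s i t j` with decoupled
processes. The process `z` dominates the second order error. -/
theorem integral_bilinear_le {T μ : Type*} [Fintype T] [Nonempty T] [Fintype μ]
    (a : ι → κ → ℝ) (s : T → ι → ℝ) (t : T → κ → ℝ) (z : T → μ → ℝ)
    (hz : ∀ α β, 1 / 2 * |∑ i, ∑ j, a i j ^ 2 *
      ((s α i ^ 2 - s β i ^ 2) * (t α j ^ 2 - t β j ^ 2))| ≤ ∑ v, (z α v - z β v) ^ 2)
    {F : (ι × κ → ℝ) → ℝ} {Ψ₁ : (ι → ℝ) → ℝ} {Ψ₂ : (κ → ℝ) → ℝ} {Ψ₃ : (μ → ℝ) → ℝ}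
    (hF : Integrable F (_root_.stdGaussian (ι × κ)))
    (hΨ₁ : Integrable Ψ₁ (_root_.stdGaussian ι)) (hΨ₂ : Integrable Ψ₂ (_root_.stdGaussian κ))
    (hΨ₃ : Integrable Ψ₃ (_root_.stdGaussian μ))
    (hFx : ∀ g, ∃ α, F g ≤ ∑ i, ∑ j, a i j * g (i, j) * s α i * t α j)
    (h₁ : ∀ g α, ∑ i, rowNorm (fun i j => a i j ^ 2) (t α) i * s α i * g i ≤ Ψ₁ g)
    (h₂ : ∀ g α, ∑ j, rowNorm (fun j i => a i j ^ 2) (s α) j * t α j * g j ≤ Ψ₂ g)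
    (h₃ : ∀ g α, ∑ v, z α v * g v ≤ Ψ₃ g) :
    ∫ g, F g ∂_root_.stdGaussian (ι × κ) ≤ ∫ g, Ψ₁ g ∂_root_.stdGaussian ι
      + ∫ g, Ψ₂ g ∂_root_.stdGaussian κ + ∫ g, Ψ₃ g ∂_root_.stdGaussian μ := by
  have p₁ := measurePreserving_comp_injective (κ := ι) (ν := ι ⊕ κ ⊕ μ) Sum.inl_injective
  have p₂ := measurePreserving_comp_injective (κ := κ) (ν := ι ⊕ κ ⊕ μ)
    (Sum.inr_injective.comp Sum.inl_injective)
  have p₃ := measurePreserving_comp_injective (κ := μ) (ν := ι ⊕ κ ⊕ μ)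
    (Sum.inr_injective.comp Sum.inr_injective)
  have i₁ := p₁.integrable_comp_of_integrable hΨ₁
  have i₂ := p₂.integrable_comp_of_integrable hΨ₂
  have i₃ := p₃.integrable_comp_of_integrable hΨ₃
  have main := integral_le_of_sudakovFernique (T := T)
    (fun α (ij : ι × κ) => a ij.1 ij.2 * s α ij.1 * t α ij.2)
    (fun α => Sum.elim (fun i => rowNorm (fun i j => a i j ^ 2) (t α) i * s α i)
      (Sum.elim (fun j => rowNorm (fun j i => a i j ^ 2) (s α) j * t α j) (z α)))
    (fun α β => ?_) hF ((i₁.add i₂).add i₃) (fun g => ?_) (fun g α => ?_)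
  · refine main.trans (le_of_eq ?_)
    rw [integral_add' (i₁.add i₂) i₃, integral_add' i₁ i₂, ← integral_comp_measurePreserving p₁ hΨ₁,
      ← integral_comp_measurePreserving p₂ hΨ₂, ← integral_comp_measurePreserving p₃ hΨ₃]
    rfl
  · have h := increment_le (b := fun i j => a i j ^ 2) (fun i j => sq_nonneg _)
      (s α) (s β) (t α) (t β)
    simp only [Fintype.sum_sum_type, Sum.elim_inl, Sum.elim_inr, Fintype.sum_prod_type]
    have e1 : ∑ i, ∑ j, (a i j * s α i * t α j - a i j * s β i * t β j) ^ 2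
        = ∑ i, ∑ j, a i j ^ 2 * (s α i * t α j - s β i * t β j) ^ 2 :=
      Finset.sum_congr rfl fun i _ => Finset.sum_congr rfl fun j _ => by ring
    rw [e1]
    linarith [hz α β]
  · obtain ⟨α, hα⟩ := hFx g
    refine ⟨α, hα.trans (le_of_eq ?_)⟩
    rw [Fintype.sum_prod_type]
    exact Finset.sum_congr rfl fun i _ => Finset.sum_congr rfl fun j _ => by ring
  · simp only [Fintype.sum_sum_type, Sum.elim_inl, Sum.elim_inr]
    have a1 := h₁ (g ∘ Sum.inl) α
    have a2 := h₂ (g ∘ Sum.inr ∘ Sum.inl) α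
    have a3 := h₃ (g ∘ Sum.inr ∘ Sum.inr) α
    simp only [Function.comp_apply] at a1 a2 a3
    simp only [Pi.add_apply, Function.comp_def] at a1 a2 a3 ⊢
    linarith

end ProductProcess

section ExponentialMoments

variable {ι ν : Type*} [Fintype ι] [Fintype ν]

theorem integrable_exp_linear (c : ν → ℝ) :
    Integrable (fun g => Real.exp (∑ v, c v * g v)) (_root_.stdGaussian ν) := by
  simp only [Real.exp_sum]
  exact Integrable.fintype_prod (f := fun v x => Real.exp (c v * x))
    fun v => integrable_exp_mul_gaussianReal (c v)

theorem integral_exp_linear (c : ν → ℝ) :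
    ∫ g, Real.exp (∑ v, c v * g v) ∂_root_.stdGaussian ν = Real.exp ((∑ v, c v ^ 2) / 2) := by
  simp only [Real.exp_sum, Finset.sum_div]
  refine (integral_fintype_prod_eq_prod (fun v x => Real.exp (c v * x))).trans ?_
  refine Finset.prod_congr rfl fun v _ => ?_
  have := congrFun (mgf_id_gaussianReal (μ := 0) (v := 1)) (c v)
  simp only [mgf, id] at this
  rw [this]
  simp

theorem le_add_exp_sub (x c : ℝ) : x ≤ c + Real.exp (x - c) := by
  linarith [Real.add_one_le_exp (x - c)]

theorem exp_half_le_two : Real.exp (1 / 2) ≤ 2 := by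
  have h : Real.exp (1 / 2) ^ 2 = Real.exp 1 := by
    rw [← Real.exp_nat_mul]; norm_num
  nlinarith [Real.exp_one_lt_d9, Real.exp_pos (1 / 2)]

/-- A maximal inequality for at most `exp L` Gaussian variables of variance at most `β ^ 2`. -/
theorem exists_bound_linear {β L : ℝ} (hβ : 0 < β) (hL : 1 ≤ L) (c : ι → ν → ℝ)
    (hc : ∀ i, ∑ v, c i v ^ 2 ≤ β ^ 2) (hι : (Fintype.card ι : ℝ) ≤ Real.exp L) :
    ∃ Ψ : (ν → ℝ) → ℝ, Integrable Ψ (_root_.stdGaussian ν) ∧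
      ∫ g, Ψ g ∂_root_.stdGaussian ν ≤ 5 * β * L ∧ ∀ g i, |∑ v, c i v * g v| ≤ Ψ g := by
  have i0 : ∀ i, Integrable (fun g : ν → ℝ => Real.exp (∑ v, c i v / β * g v)
      + Real.exp (∑ v, -(c i v / β) * g v)) (_root_.stdGaussian ν) :=
    fun i => (integrable_exp_linear _).add (integrable_exp_linear _)
  have i1 := integrable_finsetSum Finset.univ fun i _ => i0 i
  refine ⟨fun g => β * (L + Real.exp (-L) * ∑ i, (Real.exp (∑ v, c i v / β * g v)
    + Real.exp (∑ v, -(c i v / β) * g v))),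
    ((integrable_const _).add (i1.const_mul _)).const_mul _, ?_, fun g i => ?_⟩
  · rw [integral_const_mul, integral_add (integrable_const _) (i1.const_mul _),
      integral_const_mul, integral_finsetSum _ fun i _ => i0 i]
    have h1 : ∀ i, ∫ g, (Real.exp (∑ v, c i v / β * g v)
        + Real.exp (∑ v, -(c i v / β) * g v)) ∂_root_.stdGaussian ν ≤ 4 := by
      intro i
      have h2 : (∑ v, (c i v / β) ^ 2) / 2 ≤ 1 / 2 := by
        simp only [div_pow, ← Finset.sum_div]
        have : (∑ v, c i v ^ 2) / β ^ 2 ≤ 1 := (div_le_one (by positivity)).2 (hc i)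
        linarith
      rw [integral_add (integrable_exp_linear _) (integrable_exp_linear _),
        integral_exp_linear, integral_exp_linear]
      simp only [neg_sq]
      linarith [Real.exp_le_exp.2 h2, exp_half_le_two]
    have h3 := Finset.sum_le_sum fun i (_ : i ∈ Finset.univ) => h1 i
    rw [Finset.sum_const, nsmul_eq_mul, Finset.card_univ] at h3
    have h4 : Real.exp (-L) * ∑ i, ∫ g, (Real.exp (∑ v, c i v / β * g v)
        + Real.exp (∑ v, -(c i v / β) * g v)) ∂_root_.stdGaussian ν ≤ 4 := by
      calc _ ≤ Real.exp (-L) * (Real.exp L * 4) := by gcongr; linarith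
        _ = 4 := by rw [← mul_assoc, ← Real.exp_add]; simp
    simp only [integral_const, probReal_univ, one_smul]
    calc _ ≤ β * (L + 4) := by gcongr
      _ ≤ 5 * β * L := by nlinarith
  · have e : ∑ v, c i v / β * g v = (∑ v, c i v * g v) / β := by
      rw [Finset.sum_div]; exact Finset.sum_congr rfl fun v _ => by ring
    have e' : ∑ v, -(c i v / β) * g v = -((∑ v, c i v * g v) / β) := by
      rw [← e, ← Finset.sum_neg_distrib]; exact Finset.sum_congr rfl fun v _ => by ring
    have h1 : Real.exp ((∑ v, c i v * g v) / β) + Real.exp (-((∑ v, c i v * g v) / β)) ≤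
        ∑ i, (Real.exp (∑ v, c i v / β * g v) + Real.exp (∑ v, -(c i v / β) * g v)) := by
      rw [← e', ← e]
      exact Finset.single_le_sum (f := fun i => Real.exp (∑ v, c i v / β * g v)
        + Real.exp (∑ v, -(c i v / β) * g v)) (fun i _ => by positivity) (Finset.mem_univ i)
    have h2 : |(∑ v, c i v * g v) / β| ≤ L + Real.exp (-L) *
        (Real.exp ((∑ v, c i v * g v) / β) + Real.exp (-((∑ v, c i v * g v) / β))) := by
      set x := (∑ v, c i v * g v) / β
      have h3 := le_add_exp_sub |x| L
      have h4 : Real.exp (|x| - L) ≤ Real.exp (-L) * (Real.exp x + Real.exp (-x)) := by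
        rw [sub_eq_add_neg, add_comm, Real.exp_add]
        gcongr
        rcases abs_cases x with ⟨h, _⟩ | ⟨h, _⟩ <;> rw [h] <;>
          linarith [Real.exp_pos x, Real.exp_pos (-x)]
      linarith
    calc |∑ v, c i v * g v| = β * |(∑ v, c i v * g v) / β| := by
          rw [abs_div, abs_of_pos hβ]; field_simp
      _ ≤ _ := by
          exact mul_le_mul_of_nonneg_left (h2.trans (by gcongr)) hβ.le

/-- The maximum of at most `exp L` standard Gaussian variables. -/
theorem exists_bound_eval {L : ℝ} (hL : 1 ≤ L) (hν : (Fintype.card ν : ℝ) ≤ Real.exp L) :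
    ∃ Ψ : (ν → ℝ) → ℝ, Integrable Ψ (_root_.stdGaussian ν) ∧
      ∫ g, Ψ g ∂_root_.stdGaussian ν ≤ 5 * L ∧ ∀ g v, |g v| ≤ Ψ g := by
  classical
  obtain ⟨Ψ, h1, h2, h3⟩ := exists_bound_linear (β := 1) one_pos hL
    (fun i v : ν => if v = i then (1 : ℝ) else 0) (fun i => by simp) hν
  exact ⟨Ψ, h1, by simpa using h2, fun g v => by simpa using h3 g v⟩

end ExponentialMoments

section DecoupledTerm

theorem gaussianPDFReal_mul_exp_sq (x : ℝ) :
    gaussianPDFReal 0 1 x * Real.exp (x ^ 2 / 4) =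
      (Real.sqrt (2 * Real.pi))⁻¹ * Real.exp (-(1 / 4) * x ^ 2) := by
  rw [gaussianPDFReal, mul_assoc, ← Real.exp_add]
  congr 2
  · simp
  · simp; ring

theorem integrable_exp_sq_gaussianReal :
    Integrable (fun x => Real.exp (x ^ 2 / 4)) (gaussianReal 0 1) := by
  rw [gaussianReal_of_var_ne_zero _ one_ne_zero,
    integrable_withDensity_iff_integrable_smul₀' (measurable_gaussianPDF 0 1).aemeasurable
      (.of_forall fun _ => gaussianPDF_lt_top)]
  simp only [toReal_gaussianPDF, smul_eq_mul, gaussianPDFReal_mul_exp_sq]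
  exact (integrable_exp_neg_mul_sq (by norm_num)).const_mul _

theorem integral_exp_sq_gaussianReal_le :
    ∫ x, Real.exp (x ^ 2 / 4) ∂gaussianReal 0 1 ≤ 2 := by
  rw [integral_gaussianReal_eq_integral_smul one_ne_zero]
  simp only [smul_eq_mul, gaussianPDFReal_mul_exp_sq]
  rw [integral_const_mul, integral_gaussian, inv_mul_le_iff₀ (by positivity),
    Real.sqrt_le_left (by positivity), mul_pow, Real.sq_sqrt (by positivity)]
  nlinarith [Real.pi_pos]

theorem abs_rpow_le {Q : ℝ} (hQ : 0 < Q) (x : ℝ) :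
    |x| ^ Q ≤ Real.sqrt (2 * Q) ^ Q * Real.exp (x ^ 2 / 4) := by
  have h0 : 0 < Real.sqrt (2 * Q) := by positivity
  have h1 : |x| ≤ Real.sqrt (2 * Q) * Real.exp (x ^ 2 / (4 * Q)) := by
    have h2 := Real.add_one_le_exp (x ^ 2 / (4 * Q))
    have h3 : |x| / Real.sqrt (2 * Q) ≤ x ^ 2 / (4 * Q) + 1 := by
      have h4 : x ^ 2 / (4 * Q) = (|x| / Real.sqrt (2 * Q)) ^ 2 / 2 := by
        rw [div_pow, Real.sq_sqrt (by positivity), sq_abs]; field_simp; ring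
      rw [h4]
      nlinarith [sq_nonneg (|x| / Real.sqrt (2 * Q) - 1)]
    rw [div_le_iff₀ h0] at h3
    nlinarith
  refine (Real.rpow_le_rpow (abs_nonneg x) h1 hQ.le).trans (le_of_eq ?_)
  rw [Real.mul_rpow h0.le (Real.exp_pos _).le, ← Real.exp_mul]
  congr 2
  field_simp

theorem integral_exp_trunc_le {Q c L : ℝ} (hQ : 0 < Q) (hL : 0 ≤ L) (hc : 0 ≤ c)
    (hcL : c * L ^ Q ≤ 1) :
    ∫ x, Real.exp (c * min |x| L ^ Q) ∂gaussianReal 0 1 ≤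
      Real.exp (4 * c * Real.sqrt (2 * Q) ^ Q) := by
  have h1 : ∀ x : ℝ, Real.exp (c * min |x| L ^ Q) ≤
      1 + 2 * c * Real.sqrt (2 * Q) ^ Q * Real.exp (x ^ 2 / 4) := by
    intro x
    have m0 : 0 ≤ min |x| L := le_min (abs_nonneg x) hL
    have y0 : 0 ≤ c * min |x| L ^ Q := by positivity
    have y1 : c * min |x| L ^ Q ≤ 1 :=
      le_trans (by gcongr; exact min_le_right _ _) hcL
    have h2 := Real.abs_exp_sub_one_le (x := c * min |x| L ^ Q) (by rwa [abs_of_nonneg y0])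
    rw [abs_of_nonneg y0] at h2
    have h3 : c * min |x| L ^ Q ≤ c * (Real.sqrt (2 * Q) ^ Q * Real.exp (x ^ 2 / 4)) := by
      gcongr
      exact (Real.rpow_le_rpow m0 (min_le_left _ _) hQ.le).trans (abs_rpow_le hQ x)
    linarith [le_abs_self (Real.exp (c * min |x| L ^ Q) - 1)]
  have i1 := integrable_exp_sq_gaussianReal.const_mul (2 * c * Real.sqrt (2 * Q) ^ Q)
  have i2 : Integrable (fun x => 1 + 2 * c * Real.sqrt (2 * Q) ^ Q * Real.exp (x ^ 2 / 4))
      (gaussianReal 0 1) := (integrable_const 1).add i1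
  refine (integral_mono_of_nonneg (.of_forall fun x => (Real.exp_pos _).le) i2
    (.of_forall h1)).trans ?_
  rw [integral_add (integrable_const 1) i1, integral_const_mul, integral_const,
    probReal_univ, one_smul]
  have h4 : 2 * c * Real.sqrt (2 * Q) ^ Q * ∫ x, Real.exp (x ^ 2 / 4) ∂gaussianReal 0 1
      ≤ 2 * c * Real.sqrt (2 * Q) ^ Q * 2 := by
    gcongr; exact integral_exp_sq_gaussianReal_le
  linarith [Real.add_one_le_exp (4 * c * Real.sqrt (2 * Q) ^ Q)]

variable {ι κ : Type*}

theorem measurable_exp_trunc {Q c L : ℝ} :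
    Measurable (fun x : ℝ => Real.exp (c * min |x| L ^ Q)) :=
  (((measurable_id.abs.min measurable_const).pow_const Q).const_mul c).exp

theorem integrable_exp_sum_trunc [Fintype ι] {Q L : ℝ} (hQ : 0 < Q) (hL : 0 ≤ L) {c : ι → ℝ}
    (hc : ∀ i, 0 ≤ c i) :
    Integrable (fun g : ι → ℝ => Real.exp (∑ i, c i * min |g i| L ^ Q))
      (_root_.stdGaussian ι) := by
  simp only [Real.exp_sum]
  refine Integrable.fintype_prod (f := fun i x => Real.exp (c i * min |x| L ^ Q)) fun i =>
    Integrable.of_bound measurable_exp_trunc.aestronglyMeasurable (Real.exp (c i * L ^ Q))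
      (.of_forall fun x => ?_)
  rw [Real.norm_eq_abs, Real.abs_exp, Real.exp_le_exp]
  have m0 : 0 ≤ min |x| L := le_min (abs_nonneg x) hL
  exact mul_le_mul_of_nonneg_left (Real.rpow_le_rpow m0 (min_le_right _ _) hQ.le) (hc i)

theorem integral_exp_sum_trunc_le [Fintype ι] {Q L : ℝ} (hQ : 0 < Q) (hL : 0 ≤ L) {c : ι → ℝ}
    (hc : ∀ i, 0 ≤ c i) (hcL : ∀ i, c i * L ^ Q ≤ 1) :
    ∫ g : ι → ℝ, Real.exp (∑ i, c i * min |g i| L ^ Q) ∂_root_.stdGaussian ι ≤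
      Real.exp (4 * (∑ i, c i) * Real.sqrt (2 * Q) ^ Q) := by
  simp only [Real.exp_sum]
  refine (integral_fintype_prod_eq_prod (fun i x => Real.exp (c i * min |x| L ^ Q))).le.trans ?_
  refine (Finset.prod_le_prod (fun i _ => integral_nonneg fun x => (Real.exp_pos _).le)
    fun i _ => integral_exp_trunc_le hQ hL (hc i) (hcL i)).trans (le_of_eq ?_)
  rw [← Real.exp_sum, Finset.mul_sum, Finset.sum_mul]

variable [Fintype κ]

theorem rowNorm_nonneg (b : ι → κ → ℝ) (t : κ → ℝ) (i : ι) : 0 ≤ rowNorm b t i :=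
  Real.sqrt_nonneg _

theorem rowNorm_le {A : ι → κ → ℝ} {a : ℝ} (ha : 0 ≤ a) (hA : ∀ i j, |A i j| ≤ a) {t : κ → ℝ}
    (ht : ∑ j, t j ^ 2 ≤ 1) (i : ι) : rowNorm (fun i j => A i j ^ 2) t i ≤ a := by
  refine (Real.sqrt_le_left ha).2 ?_
  calc ∑ j, A i j ^ 2 * t j ^ 2 ≤ ∑ j, a ^ 2 * t j ^ 2 := by
        refine Finset.sum_le_sum fun j _ => mul_le_mul_of_nonneg_right ?_ (sq_nonneg _)
        exact sq_le_sq.2 ((hA i j).trans (le_abs_self a))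
    _ = a ^ 2 * ∑ j, t j ^ 2 := by rw [Finset.mul_sum]
    _ ≤ a ^ 2 := mul_le_of_le_one_right (sq_nonneg a) ht

theorem rowNorm_rpow_le {A : ι → κ → ℝ} {Q : ℝ} (hQ : 2 ≤ Q) {t : κ → ℝ}
    (ht : ∑ j, t j ^ 2 ≤ 1) (i : ι) :
    rowNorm (fun i j => A i j ^ 2) t i ^ Q ≤ ∑ j, t j ^ 2 * |A i j| ^ Q := by
  have hQ2 : 1 ≤ Q / 2 := by linarith
  have h1 := Real.inner_le_weight_mul_Lp_of_nonneg Finset.univ hQ2 (fun j => t j ^ 2)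
    (fun j => A i j ^ 2) (fun j => sq_nonneg _) (fun j => sq_nonneg _)
  have e : ∀ j, (A i j ^ 2) ^ (Q / 2) = |A i j| ^ Q := by
    intro j
    rw [← sq_abs, ← Real.rpow_natCast, ← Real.rpow_mul (abs_nonneg _)]
    congr 1; push_cast; ring
  simp only [e] at h1
  set X := ∑ j, t j ^ 2 * |A i j| ^ Q with hX
  have X0 : 0 ≤ X := Finset.sum_nonneg fun j _ => by positivity
  have h2 : ∑ j, A i j ^ 2 * t j ^ 2 ≤ X ^ (Q / 2)⁻¹ := by
    calc ∑ j, A i j ^ 2 * t j ^ 2 = ∑ j, t j ^ 2 * A i j ^ 2 := by simp only [mul_comm]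
      _ ≤ _ := h1
      _ ≤ 1 * X ^ (Q / 2)⁻¹ := by
        gcongr
        exact Real.rpow_le_one (Finset.sum_nonneg fun j _ => sq_nonneg _) ht
          (sub_nonneg.2 (inv_le_one_of_one_le₀ hQ2))
      _ = _ := one_mul _
  have h0 : 0 ≤ ∑ j, A i j ^ 2 * t j ^ 2 := Finset.sum_nonneg fun j _ => by positivity
  rw [rowNorm, Real.sqrt_eq_rpow, ← Real.rpow_mul h0]
  calc _ ≤ (X ^ (Q / 2)⁻¹) ^ (1 / 2 * Q) := by gcongr
    _ = X := by
      rw [← Real.rpow_mul X0]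
      have : (Q / 2)⁻¹ * (1 / 2 * Q) = 1 := by field_simp
      rw [this, Real.rpow_one]

variable [Fintype ι]

theorem sum_rowNorm_trunc_rpow_le {A : ι → κ → ℝ} {Q L a D : ℝ} (hQ : 2 ≤ Q) (hL : 1 ≤ L)
    (ha : 0 < a) (hD : 0 ≤ D) {t : κ → ℝ} (ht : ∑ j, t j ^ 2 ≤ 1) (g : ι → ℝ) :
    (∑ i, (min |g i| L * rowNorm (fun i j => A i j ^ 2) t i) ^ Q) ^ (1 / Q) ≤
      (2 * Real.sqrt (2 * Q) * D + L ^ 2 * a) * (1 + ∑ j,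
        Real.exp (-L - 4 * ((a * L) ^ Q)⁻¹ * D ^ Q * Real.sqrt (2 * Q) ^ Q) *
          Real.exp (∑ i, ((a * L) ^ Q)⁻¹ * |A i j| ^ Q * min |g i| L ^ Q)) := by
  have hQ0 : 0 < Q := by linarith
  set R := 4 * D ^ Q * Real.sqrt (2 * Q) ^ Q + L * (a * L) ^ Q with hR
  set E : κ → ℝ := fun j =>
    Real.exp (-L - 4 * ((a * L) ^ Q)⁻¹ * D ^ Q * Real.sqrt (2 * Q) ^ Q) *
          Real.exp (∑ i, ((a * L) ^ Q)⁻¹ * |A i j| ^ Q * min |g i| L ^ Q) with hE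
  have E0 : ∀ j, 0 ≤ E j := fun j => by positivity
  have hθ : 0 < (a * L) ^ Q := by positivity
  have m0 : ∀ i, 0 ≤ min |g i| L := fun i => le_min (abs_nonneg _) (by linarith)
  have hS : ∀ j, ∑ i, |A i j| ^ Q * min |g i| L ^ Q ≤ R * (1 + E j) := by
    intro j
    have h1 := le_add_exp_sub (∑ i, ((a * L) ^ Q)⁻¹ * |A i j| ^ Q * min |g i| L ^ Q)
      (L + 4 * ((a * L) ^ Q)⁻¹ * D ^ Q * Real.sqrt (2 * Q) ^ Q)
    have h2 : Real.exp (∑ i, ((a * L) ^ Q)⁻¹ * |A i j| ^ Q * min |g i| L ^ Q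
      - (L + 4 * ((a * L) ^ Q)⁻¹ * D ^ Q * Real.sqrt (2 * Q) ^ Q)) = E j := by
      simp only [hE]; rw [← Real.exp_add]; congr 1; ring
    rw [h2] at h1
    have h3 := mul_le_mul_of_nonneg_left h1 hθ.le
    have e1 : (a * L) ^ Q * ∑ i, ((a * L) ^ Q)⁻¹ * |A i j| ^ Q * min |g i| L ^ Q
        = ∑ i, |A i j| ^ Q * min |g i| L ^ Q := by
      rw [Finset.mul_sum]
      refine Finset.sum_congr rfl fun i _ => ?_
      field_simp
    have e2 : (a * L) ^ Q * (L + 4 * ((a * L) ^ Q)⁻¹ * D ^ Q * Real.sqrt (2 * Q) ^ Q + E j)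
        = R + (a * L) ^ Q * E j := by
      rw [hR]; field_simp; ring
    rw [e1, e2] at h3
    have h4 : (a * L) ^ Q ≤ R := by
      have : 0 ≤ 4 * D ^ Q * Real.sqrt (2 * Q) ^ Q := by positivity
      nlinarith
    nlinarith [mul_le_mul_of_nonneg_right h4 (E0 j)]
  have hRX : R ≤ (2 * Real.sqrt (2 * Q) * D + L ^ 2 * a) ^ Q := by
    refine le_trans ?_ (Real.add_rpow_le_rpow_add (p := Q) (by positivity) (by positivity)
      (by linarith))
    rw [Real.mul_rpow (by positivity) hD, Real.mul_rpow (by positivity) (by positivity)]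
    have e3 : (L ^ 2 * a) ^ Q = L ^ Q * (a * L) ^ Q := by
      rw [← Real.mul_rpow (by positivity) (by positivity)]; congr 1; ring
    have h4 : (4 : ℝ) ≤ 2 ^ Q := by
      calc (4 : ℝ) = 2 ^ (2 : ℝ) := by norm_num
        _ ≤ 2 ^ Q := Real.rpow_le_rpow_of_exponent_le (by norm_num) hQ
    have h5 : L ≤ L ^ Q := Real.self_le_rpow_of_one_le hL (by linarith)
    rw [hR, e3]
    have h6 : 0 ≤ D ^ Q * Real.sqrt (2 * Q) ^ Q := by positivity
    nlinarith [mul_le_mul_of_nonneg_right h4 h6, mul_le_mul_of_nonneg_right h5 hθ.le]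
  have hsum : ∑ i, (min |g i| L * rowNorm (fun i j => A i j ^ 2) t i) ^ Q
      ≤ R * (1 + ∑ j, E j) := by
    have R0 : 0 ≤ R := by positivity
    calc _ ≤ ∑ i, ∑ j, t j ^ 2 * (|A i j| ^ Q * min |g i| L ^ Q) := by
          refine Finset.sum_le_sum fun i _ => ?_
          rw [Real.mul_rpow (m0 i) (rowNorm_nonneg _ _ _)]
          refine (mul_le_mul_of_nonneg_left (rowNorm_rpow_le hQ ht i)
            (Real.rpow_nonneg (m0 i) Q)).trans (le_of_eq ?_)
          rw [Finset.mul_sum]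
          exact Finset.sum_congr rfl fun j _ => by ring
      _ = ∑ j, t j ^ 2 * ∑ i, |A i j| ^ Q * min |g i| L ^ Q := by
          rw [Finset.sum_comm]; simp only [Finset.mul_sum]
      _ ≤ ∑ j, t j ^ 2 * (R * (1 + ∑ j, E j)) := by
          refine Finset.sum_le_sum fun j _ => mul_le_mul_of_nonneg_left ((hS j).trans ?_)
            (sq_nonneg _)
          gcongr
          exact Finset.single_le_sum (fun j _ => E0 j) (Finset.mem_univ j)
      _ = (∑ j, t j ^ 2) * (R * (1 + ∑ j, E j)) := by rw [Finset.sum_mul]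
      _ ≤ _ := mul_le_of_le_one_left
          (mul_nonneg R0 (by linarith [Finset.sum_nonneg fun j (_ : j ∈ Finset.univ) => E0 j])) ht
  have hE1 : 1 ≤ 1 + ∑ j, E j := by
    linarith [Finset.sum_nonneg fun j (_ : j ∈ Finset.univ) => E0 j]
  have hX0 : 0 ≤ 2 * Real.sqrt (2 * Q) * D + L ^ 2 * a := by positivity
  calc _ ≤ (((2 * Real.sqrt (2 * Q) * D + L ^ 2 * a) * (1 + ∑ j, E j)) ^ Q) ^ (1 / Q) := by
        refine Real.rpow_le_rpow (Finset.sum_nonneg fun i _ => Real.rpow_nonneg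
          (mul_nonneg (m0 i) (rowNorm_nonneg _ _ _)) _) (hsum.trans ?_) (by positivity)
        rw [Real.mul_rpow hX0 (by linarith)]
        exact mul_le_mul hRX (Real.self_le_rpow_of_one_le hE1 (by linarith)) (by linarith)
          (by positivity)
    _ = _ := by
        rw [← Real.rpow_mul (by positivity), mul_one_div_cancel hQ0.ne', Real.rpow_one]

theorem abs_le_min_add_exp (x L : ℝ) :
    |x| ≤ min |x| L + Real.exp (-L) * (Real.exp x + Real.exp (-x)) := by
  have h4 : Real.exp (|x| - L) ≤ Real.exp (-L) * (Real.exp x + Real.exp (-x)) := by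
    rw [sub_eq_add_neg, add_comm, Real.exp_add]
    gcongr
    rcases abs_cases x with ⟨h, _⟩ | ⟨h, _⟩ <;> rw [h] <;>
      linarith [Real.exp_pos x, Real.exp_pos (-x)]
  rcases le_total |x| L with h | h
  · rw [min_eq_left h]; linarith [Real.exp_pos (|x| - L)]
  · rw [min_eq_right h]; linarith [le_add_exp_sub |x| L]

theorem exists_bound_rowNorm {A : ι → κ → ℝ} {Q Q' L a D : ℝ} (hQ : 2 ≤ Q)
    (hQQ' : Q.HolderConjugate Q') (hL : 1 ≤ L) (ha : 0 < a) (hD : 0 ≤ D)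
    (hA : ∀ i j, |A i j| ≤ a) (hAD : ∀ j, ∑ i, |A i j| ^ Q ≤ D ^ Q)
    (hι : (Fintype.card ι : ℝ) ≤ Real.exp L) (hκ : (Fintype.card κ : ℝ) ≤ Real.exp L) :
    ∃ Ψ : (ι → ℝ) → ℝ, Integrable Ψ (_root_.stdGaussian ι) ∧
      ∫ g, Ψ g ∂_root_.stdGaussian ι ≤ 6 * (Real.sqrt Q * D + L ^ 2 * a) ∧
      ∀ g (s : ι → ℝ) (t : κ → ℝ), ∑ i, |s i| ^ Q' ≤ 1 → (∀ i, |s i| ≤ 1) → ∑ j, t j ^ 2 ≤ 1 →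
        ∑ i, rowNorm (fun i j => A i j ^ 2) t i * s i * g i ≤ Ψ g := by
  have hQ0 : 0 < Q := by linarith
  set θ := ((a * L) ^ Q)⁻¹ with hθ
  have θ0 : 0 < θ := by positivity
  set w := Real.exp (-L - 4 * θ * D ^ Q * Real.sqrt (2 * Q) ^ Q) with hw
  set X := 2 * Real.sqrt (2 * Q) * D + L ^ 2 * a with hX
  have X0 : 0 ≤ X := by positivity
  have i0 : ∀ j, Integrable (fun g : ι → ℝ =>
      Real.exp (∑ i, θ * |A i j| ^ Q * min |g i| L ^ Q)) (_root_.stdGaussian ι) :=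
    fun j => integrable_exp_sum_trunc hQ0 (by linarith) fun i => by positivity
  have i1 : Integrable (fun g : ι → ℝ =>
      1 + ∑ j, w * Real.exp (∑ i, θ * |A i j| ^ Q * min |g i| L ^ Q)) (_root_.stdGaussian ι) :=
    (integrable_const 1).add (integrable_finsetSum Finset.univ fun j _ => (i0 j).const_mul w)
  have k0 : ∀ i, Integrable (fun g : ι → ℝ => Real.exp (g i) + Real.exp (-g i))
      (_root_.stdGaussian ι) := by
    intro i
    refine integrable_comp_eval (μ := fun _ : ι => gaussianReal 0 1) (i := i)
      (f := fun x : ℝ => Real.exp x + Real.exp (-x)) ?_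
    exact Integrable.add (f := fun x => Real.exp x) (g := fun x => Real.exp (-x))
      (by simpa using integrable_exp_mul_gaussianReal (μ := 0) (v := 1) 1)
      (by simpa using integrable_exp_mul_gaussianReal (μ := 0) (v := 1) (-1))
  have k1 := integrable_finsetSum Finset.univ fun i _ => k0 i
  have k2 : ∀ i, ∫ g : ι → ℝ, (Real.exp (g i) + Real.exp (-g i)) ∂_root_.stdGaussian ι ≤ 4 := by
    classical
    intro i
    have e1 := integral_exp_linear (fun v : ι => if v = i then (1 : ℝ) else 0)
    have e2 := integral_exp_linear (fun v : ι => if v = i then (-1 : ℝ) else 0)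
    have j1 := integrable_exp_linear (fun v : ι => if v = i then (1 : ℝ) else 0)
    have j2 := integrable_exp_linear (fun v : ι => if v = i then (-1 : ℝ) else 0)
    simp only [ite_mul, zero_mul, one_mul, neg_mul, Finset.sum_ite_eq', Finset.mem_univ, if_true,
      ite_pow, ne_eq, OfNat.ofNat_ne_zero, not_false_eq_true, zero_pow, one_pow, neg_sq] at e1 e2 j1 j2
    rw [integral_add j1 j2, e1, e2]
    linarith [exp_half_le_two]
  refine ⟨fun g => X * (1 + ∑ j, w * Real.exp (∑ i, θ * |A i j| ^ Q * min |g i| L ^ Q))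
    + a * (Real.exp (-L) * ∑ i, (Real.exp (g i) + Real.exp (-g i))),
    (i1.const_mul X).add ((k1.const_mul _).const_mul a), ?_, ?_⟩
  · have e1 : ∫ g : ι → ℝ, (1 + ∑ j, w * Real.exp (∑ i, θ * |A i j| ^ Q * min |g i| L ^ Q))
        ∂_root_.stdGaussian ι ≤ 2 := by
      rw [integral_add (integrable_const _)
        (integrable_finsetSum Finset.univ fun j _ => (i0 j).const_mul w),
        integral_finsetSum _ fun j _ => (i0 j).const_mul w, integral_const, probReal_univ,
        one_smul]
      have : ∀ j, ∫ g : ι → ℝ, w * Real.exp (∑ i, θ * |A i j| ^ Q * min |g i| L ^ Q)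
          ∂_root_.stdGaussian ι ≤ Real.exp (-L) := by
        intro j
        have h1 := integral_exp_sum_trunc_le hQ0 (by linarith : 0 ≤ L)
          (c := fun i => θ * |A i j| ^ Q) (fun i => by positivity) fun i => by
            calc θ * |A i j| ^ Q * L ^ Q ≤ θ * a ^ Q * L ^ Q := by gcongr; exact hA i j
              _ = 1 := by
                rw [mul_assoc, ← Real.mul_rpow ha.le (by linarith), hθ]
                exact inv_mul_cancel₀ (by positivity)
        rw [integral_const_mul, ← Finset.mul_sum] at *
        calc _ ≤ w * Real.exp (4 * (θ * D ^ Q) * Real.sqrt (2 * Q) ^ Q) := by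
              gcongr
              refine h1.trans ?_
              gcongr
              exact hAD j
          _ = Real.exp (-L) := by
              rw [hw, ← Real.exp_add]; congr 1; ring
      have h2 := Finset.sum_le_sum fun j (_ : j ∈ Finset.univ) => this j
      rw [Finset.sum_const, nsmul_eq_mul, Finset.card_univ] at h2
      have h3 : (Fintype.card κ : ℝ) * Real.exp (-L) ≤ 1 := by
        calc _ ≤ Real.exp L * Real.exp (-L) := by gcongr
          _ = 1 := by rw [← Real.exp_add]; simp
      linarith
    have e2 : Real.exp (-L) * ∫ g : ι → ℝ, ∑ i, (Real.exp (g i) + Real.exp (-g i))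
        ∂_root_.stdGaussian ι ≤ 4 := by
      rw [integral_finsetSum _ fun i _ => k0 i]
      have h2 := Finset.sum_le_sum fun i (_ : i ∈ Finset.univ) => k2 i
      rw [Finset.sum_const, nsmul_eq_mul, Finset.card_univ] at h2
      calc _ ≤ Real.exp (-L) * (Real.exp L * 4) := by gcongr; linarith
        _ = 4 := by rw [← mul_assoc, ← Real.exp_add]; simp
    rw [integral_add (i1.const_mul X) ((k1.const_mul _).const_mul a), integral_const_mul,
      integral_const_mul, integral_const_mul]
    have h1 : X * 2 + a * 4 ≤ 6 * (Real.sqrt Q * D + L ^ 2 * a) := by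
      have h2 : Real.sqrt (2 * Q) ≤ 3 / 2 * Real.sqrt Q := by
        rw [Real.sqrt_mul (by norm_num)]
        gcongr
        exact (Real.sqrt_le_left (by norm_num)).2 (by norm_num)
      have h3 : a ≤ L ^ 2 * a := le_mul_of_one_le_left ha.le (one_le_pow₀ hL)
      rw [hX]
      nlinarith [mul_le_mul_of_nonneg_right h2 hD]
    refine le_trans (add_le_add (mul_le_mul_of_nonneg_left e1 X0)
      (mul_le_mul_of_nonneg_left e2 ha.le)) h1
  · intro g s t hs hs1 ht
    have m0 : ∀ i, 0 ≤ min |g i| L := fun i => le_min (abs_nonneg _) (by linarith)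
    have r0 : ∀ i, 0 ≤ rowNorm (fun i j => A i j ^ 2) t i := rowNorm_nonneg _ t
    have main := sum_rowNorm_trunc_rpow_le (A := A) hQ hL ha hD ht g
    have hol := Real.inner_le_Lp_mul_Lq Finset.univ
      (fun i => min |g i| L * rowNorm (fun i j => A i j ^ 2) t i) (fun i => |s i|) hQQ'
    simp only [abs_abs] at hol
    have hol2 : ∑ i, min |g i| L * rowNorm (fun i j => A i j ^ 2) t i * |s i| ≤
        (∑ i, (min |g i| L * rowNorm (fun i j => A i j ^ 2) t i) ^ Q) ^ (1 / Q) := by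
      refine hol.trans ?_
      simp only [abs_of_nonneg (mul_nonneg (m0 _) (r0 _))]
      refine mul_le_of_le_one_right (Real.rpow_nonneg (Finset.sum_nonneg fun i _ =>
        Real.rpow_nonneg (mul_nonneg (m0 i) (r0 i)) _) _) ?_
      exact Real.rpow_le_one (Finset.sum_nonneg fun i _ => by positivity) hs
        (one_div_nonneg.2 hQQ'.symm.nonneg)
    have hterm : ∀ i, rowNorm (fun i j => A i j ^ 2) t i * s i * g i ≤
        min |g i| L * rowNorm (fun i j => A i j ^ 2) t i * |s i|
          + a * (Real.exp (-L) * (Real.exp (g i) + Real.exp (-g i))) := by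
      intro i
      have h1 : s i * g i ≤ |s i| * |g i| := by rw [← abs_mul]; exact le_abs_self _
      have h2 := abs_le_min_add_exp (g i) L
      have h3 := rowNorm_le ha.le hA ht i
      set e := Real.exp (-L) * (Real.exp (g i) + Real.exp (-g i)) with he
      have e0 : 0 ≤ e := by positivity
      calc _ ≤ rowNorm (fun i j => A i j ^ 2) t i * (|s i| * (min |g i| L + e)) := by
            rw [mul_assoc]
            exact mul_le_mul_of_nonneg_left (h1.trans (by gcongr)) (r0 i)
        _ = min |g i| L * rowNorm (fun i j => A i j ^ 2) t i * |s i|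
            + (rowNorm (fun i j => A i j ^ 2) t i * |s i|) * e := by ring
        _ ≤ _ := by
            gcongr
            exact (mul_le_of_le_one_right (r0 i) (hs1 i)).trans h3
    refine (Finset.sum_le_sum fun i _ => hterm i).trans ?_
    rw [Finset.sum_add_distrib, ← Finset.mul_sum, ← Finset.mul_sum]
    exact add_le_add_left (hol2.trans main) _

end DecoupledTerm

section ErrorProcess

variable {ι κ : Type*} [Fintype ι] [Fintype κ]

theorem sum_mul_le_of_sum_le_one [Nonempty ι] {c x : ι → ℝ} {M : ℝ} (hc : ∀ i, 0 ≤ c i)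
    (hc1 : ∑ i, c i ≤ 1) (hx : ∀ i, |x i| ≤ M) : ∑ i, c i * x i ≤ M := by
  have M0 : 0 ≤ M := (abs_nonneg _).trans (hx (Classical.arbitrary ι))
  calc ∑ i, c i * x i ≤ ∑ i, c i * M :=
        Finset.sum_le_sum fun i _ => mul_le_mul_of_nonneg_left ((le_abs_self _).trans (hx i)) (hc i)
    _ = (∑ i, c i) * M := by rw [Finset.sum_mul]
    _ ≤ M := mul_le_of_le_one_left M0 hc1

theorem exists_bound_sum {Ψ₁ : (ι → ℝ) → ℝ} {Ψ₂ : (κ → ℝ) → ℝ}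
    (h₁ : Integrable Ψ₁ (_root_.stdGaussian ι)) (h₂ : Integrable Ψ₂ (_root_.stdGaussian κ))
    (c d : ℝ) :
    Integrable (fun g : ι ⊕ κ → ℝ => c * Ψ₁ (g ∘ Sum.inl) + d * Ψ₂ (g ∘ Sum.inr))
      (_root_.stdGaussian (ι ⊕ κ)) ∧
    ∫ g : ι ⊕ κ → ℝ, (c * Ψ₁ (g ∘ Sum.inl) + d * Ψ₂ (g ∘ Sum.inr)) ∂_root_.stdGaussian (ι ⊕ κ) =
      c * ∫ g, Ψ₁ g ∂_root_.stdGaussian ι + d * ∫ g, Ψ₂ g ∂_root_.stdGaussian κ := by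
  have p₁ := measurePreserving_comp_injective (κ := ι) (ν := ι ⊕ κ) Sum.inl_injective
  have p₂ := measurePreserving_comp_injective (κ := κ) (ν := ι ⊕ κ) Sum.inr_injective
  have i₁ := (p₁.integrable_comp_of_integrable h₁).const_mul c
  have i₂ := (p₂.integrable_comp_of_integrable h₂).const_mul d
  refine ⟨i₁.add i₂, ?_⟩
  rw [← integral_comp_measurePreserving p₁ h₁, ← integral_comp_measurePreserving p₂ h₂,
    ← integral_const_mul, ← integral_const_mul]
  exact integral_add i₁ i₂

/-- An auxiliary process dominating the second order error when the rows are small in `ℓ₄`. -/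
theorem exists_errorProcess_of_row [Nonempty ι] [Nonempty κ] {T : Type*} {A : ι → κ → ℝ}
    {a D L : ℝ} (ha : 0 < a) (hD : 0 < D) (hL : 1 ≤ L) (hA : ∀ i, ∑ j, A i j ^ 4 ≤ a * D ^ 3)
    (hι : (Fintype.card ι : ℝ) ≤ Real.exp L) (hκ : (Fintype.card κ : ℝ) ≤ Real.exp L)
    (s : T → ι → ℝ) (t : T → κ → ℝ) (hs : ∀ α, ∑ i, s α i ^ 2 ≤ 1)
    (ht : ∀ α, ∑ j, t α j ^ 2 ≤ 1) :
    ∃ (z : T → κ ⊕ κ → ℝ) (Ψ : (κ ⊕ κ → ℝ) → ℝ),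
      (∀ α β, 1 / 2 * |∑ i, ∑ j, A i j ^ 2 *
        ((s α i ^ 2 - s β i ^ 2) * (t α j ^ 2 - t β j ^ 2))| ≤ ∑ v, (z α v - z β v) ^ 2) ∧
      Integrable Ψ (_root_.stdGaussian (κ ⊕ κ)) ∧
      ∫ g, Ψ g ∂_root_.stdGaussian (κ ⊕ κ) ≤ 10 * (D + L ^ 4 * a) ∧
      ∀ g α, ∑ v, z α v * g v ≤ Ψ g := by
  set W := D + L ^ 4 * a with hW
  have W0 : 0 < W := by positivity
  set τ := L / W with hτ
  have τ0 : 0 < τ := by positivity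
  set β := Real.sqrt (a * D ^ 3) with hβ
  have β0 : 0 < β := by positivity
  have hβ2 : β ^ 2 = a * D ^ 3 := Real.sq_sqrt (by positivity)
  obtain ⟨Ψ₁, i₁, e₁, b₁⟩ := exists_bound_linear (ν := κ) β0 hL (fun i j => A i j ^ 2)
    (fun i => by
      rw [hβ2]
      refine le_trans (le_of_eq (Finset.sum_congr rfl fun j _ => ?_)) (hA i)
      ring) hι
  obtain ⟨Ψ₂, i₂, e₂, b₂⟩ := exists_bound_eval (ν := κ) hL hκ
  obtain ⟨i₃, e₃⟩ := exists_bound_sum i₁ i₂ τ τ⁻¹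
  refine ⟨fun α => Sum.elim (fun j => τ * ∑ i, A i j ^ 2 * s α i ^ 2)
    (fun j => τ⁻¹ * t α j ^ 2), _, fun α γ => ?_, i₃, ?_, fun g α => ?_⟩
  · simp only [Fintype.sum_sum_type, Sum.elim_inl, Sum.elim_inr]
    have e : ∑ i, ∑ j, A i j ^ 2 * ((s α i ^ 2 - s γ i ^ 2) * (t α j ^ 2 - t γ j ^ 2))
        = ∑ j, (∑ i, A i j ^ 2 * s α i ^ 2 - ∑ i, A i j ^ 2 * s γ i ^ 2)
          * (t α j ^ 2 - t γ j ^ 2) := by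
      rw [Finset.sum_comm]
      refine Finset.sum_congr rfl fun j _ => ?_
      rw [← Finset.sum_sub_distrib, Finset.sum_mul]
      exact Finset.sum_congr rfl fun i _ => by ring
    rw [e, ← Finset.sum_add_distrib]
    refine (mul_le_mul_of_nonneg_left (Finset.abs_sum_le_sum_abs _ _) (by norm_num)).trans ?_
    rw [Finset.mul_sum]
    refine Finset.sum_le_sum fun j _ => ?_
    set y := ∑ i, A i j ^ 2 * s α i ^ 2
    set y' := ∑ i, A i j ^ 2 * s γ i ^ 2
    set w := t α j ^ 2
    set w' := t γ j ^ 2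
    have h : (y - y') * (w - w') = (τ * y - τ * y') * (τ⁻¹ * w - τ⁻¹ * w') := by
      field_simp
    rw [h, abs_mul]
    nlinarith [sq_nonneg (|τ * y - τ * y'| - |τ⁻¹ * w - τ⁻¹ * w'|),
      sq_abs (τ * y - τ * y'), sq_abs (τ⁻¹ * w - τ⁻¹ * w'),
      sq_nonneg (τ * y - τ * y'), sq_nonneg (τ⁻¹ * w - τ⁻¹ * w')]
  · rw [e₃]
    have h1 : L ^ 2 * β ≤ W ^ 2 := by
      refine le_of_sq_le_sq ?_ (by positivity)
      calc (L ^ 2 * β) ^ 2 = D ^ 3 * (L ^ 4 * a) := by rw [mul_pow, hβ2]; ring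
        _ ≤ W ^ 3 * W := by
          have : 0 ≤ L ^ 4 * a := by positivity
          gcongr <;> rw [hW] <;> linarith
        _ = (W ^ 2) ^ 2 := by ring
    have h2 : τ * (5 * β * L) ≤ 5 * W := by
      rw [hτ, div_mul_eq_mul_div, div_le_iff₀ W0]
      nlinarith
    have h3 : τ⁻¹ * (5 * L) = 5 * W := by
      rw [hτ]; field_simp
    have h4 := mul_le_mul_of_nonneg_left e₁ τ0.le
    have h5 := mul_le_mul_of_nonneg_left e₂ (inv_pos.2 τ0).le
    linarith
  · simp only [Fintype.sum_sum_type, Sum.elim_inl, Sum.elim_inr, mul_assoc, ← Finset.mul_sum]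
    refine add_le_add (mul_le_mul_of_nonneg_left ?_ τ0.le)
      (mul_le_mul_of_nonneg_left ?_ (inv_pos.2 τ0).le)
    · refine le_trans (le_of_eq ?_) (sum_mul_le_of_sum_le_one (fun i => sq_nonneg (s α i)) (hs α)
        fun i => b₁ (g ∘ Sum.inl) i)
      simp only [Finset.sum_mul, Finset.mul_sum]
      rw [Finset.sum_comm]
      refine Finset.sum_congr rfl fun i _ => Finset.sum_congr rfl fun j _ => ?_
      simp only [Function.comp_apply]; ring
    · exact sum_mul_le_of_sum_le_one (fun i => sq_nonneg (t α i)) (ht α)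
        fun j => b₂ (g ∘ Sum.inr) j

theorem sq_sub_mul_add_le {x y : ℝ} (hx : 0 ≤ x) (hy : 0 ≤ y) :
    (x - y) ^ 2 * (x + y) ≤ 2 * (Real.sqrt x ^ 3 - Real.sqrt y ^ 3) ^ 2 := by
  obtain ⟨u, hu, rfl⟩ : ∃ u, 0 ≤ u ∧ u ^ 2 = x := ⟨_, Real.sqrt_nonneg x, Real.sq_sqrt hx⟩
  obtain ⟨v, hv, rfl⟩ : ∃ v, 0 ≤ v ∧ v ^ 2 = y := ⟨_, Real.sqrt_nonneg y, Real.sq_sqrt hy⟩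
  rw [Real.sqrt_sq hu, Real.sqrt_sq hv]
  have huv := mul_nonneg hu hv
  have h1 : (u + v) ^ 2 * (u ^ 2 + v ^ 2) ≤ 2 * (u ^ 2 + u * v + v ^ 2) ^ 2 := by
    nlinarith [mul_nonneg huv huv, mul_nonneg huv (sq_nonneg u), mul_nonneg huv (sq_nonneg v)]
  calc _ = (u - v) ^ 2 * ((u + v) ^ 2 * (u ^ 2 + v ^ 2)) := by ring
    _ ≤ (u - v) ^ 2 * (2 * (u ^ 2 + u * v + v ^ 2) ^ 2) := by gcongr
    _ = _ := by ring

theorem mul_sqrt_mul_le {L a D : ℝ} (ha : 0 ≤ a) (hD : 0 ≤ D) :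
    L * Real.sqrt (a * D) ≤ D + L ^ 2 * a := by
  rw [Real.sqrt_mul ha]
  nlinarith [sq_nonneg (L * Real.sqrt a - Real.sqrt D), Real.sq_sqrt ha, Real.sq_sqrt hD,
    mul_nonneg (sq_nonneg L) ha]

/-- An auxiliary process dominating the second order error for vectors in the `ℓ_{3/2}` balls. -/
theorem exists_errorProcess_of_sqrt [Nonempty ι] [Nonempty κ] {T : Type*} {A : ι → κ → ℝ}
    {a D D' L : ℝ} (ha : 0 < a) (hD : 0 < D) (hD' : 0 < D') (hL : 1 ≤ L)
    (hA : ∀ i j, |A i j| ≤ a)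
    (hι : (Fintype.card ι : ℝ) ≤ Real.exp L) (hκ : (Fintype.card κ : ℝ) ≤ Real.exp L)
    (s : T → ι → ℝ) (t : T → κ → ℝ) (hs : ∀ α, ∑ i, Real.sqrt |s α i| ^ 3 ≤ 1)
    (ht : ∀ α, ∑ j, Real.sqrt |t α j| ^ 3 ≤ 1)
    (hAt : ∀ α i, ∑ j, |A i j| * |t α j| ≤ D) (hAs : ∀ α j, ∑ i, |A i j| * |s α i| ≤ D') :
    ∃ (z : T → ι ⊕ κ → ℝ) (Ψ : (ι ⊕ κ → ℝ) → ℝ),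
      (∀ α β, 1 / 2 * |∑ i, ∑ j, A i j ^ 2 *
        ((s α i ^ 2 - s β i ^ 2) * (t α j ^ 2 - t β j ^ 2))| ≤ ∑ v, (z α v - z β v) ^ 2) ∧
      Integrable Ψ (_root_.stdGaussian (ι ⊕ κ)) ∧
      ∫ g, Ψ g ∂_root_.stdGaussian (ι ⊕ κ) ≤ 5 * (D + D' + 2 * (L ^ 2 * a)) ∧
      ∀ g α, ∑ v, z α v * g v ≤ Ψ g := by
  obtain ⟨Ψ₁, i₁, e₁, b₁⟩ := exists_bound_eval (ν := ι) hL hι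
  obtain ⟨Ψ₂, i₂, e₂, b₂⟩ := exists_bound_eval (ν := κ) hL hκ
  obtain ⟨i₃, e₃⟩ := exists_bound_sum i₁ i₂ (Real.sqrt (a * D)) (Real.sqrt (a * D'))
  have hb : ∀ i j, A i j ^ 2 ≤ a * |A i j| := by
    intro i j
    rw [← sq_abs, sq]
    exact mul_le_mul_of_nonneg_right (hA i j) (abs_nonneg _)
  refine ⟨fun α => Sum.elim (fun i => Real.sqrt (a * D) * Real.sqrt |s α i| ^ 3)
    (fun j => Real.sqrt (a * D') * Real.sqrt |t α j| ^ 3), _, fun α γ => ?_, i₃, ?_, fun g α => ?_⟩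
  · simp only [Fintype.sum_sum_type, Sum.elim_inl, Sum.elim_inr, ← mul_sub, mul_pow,
      Real.sq_sqrt (mul_pos ha hD).le, Real.sq_sqrt (mul_pos ha hD').le]
    have h1 : |∑ i, ∑ j, A i j ^ 2 * ((s α i ^ 2 - s γ i ^ 2) * (t α j ^ 2 - t γ j ^ 2))| ≤
        ∑ i, ∑ j, A i j ^ 2 * (((|s α i| - |s γ i|) ^ 2 * (|s α i| + |s γ i|) *
          (|t α j| + |t γ j|) + (|t α j| - |t γ j|) ^ 2 * (|t α j| + |t γ j|) *
          (|s α i| + |s γ i|)) / 2) := by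
      refine (Finset.abs_sum_le_sum_abs _ _).trans (Finset.sum_le_sum fun i _ =>
        (Finset.abs_sum_le_sum_abs _ _).trans (Finset.sum_le_sum fun j _ => ?_))
      rw [abs_mul, abs_of_nonneg (sq_nonneg (A i j))]
      refine mul_le_mul_of_nonneg_left ?_ (sq_nonneg _)
      rw [← sq_abs (s α i), ← sq_abs (s γ i), ← sq_abs (t α j), ← sq_abs (t γ j)]
      have S0 := mul_nonneg (add_nonneg (abs_nonneg (s α i)) (abs_nonneg (s γ i)))
        (add_nonneg (abs_nonneg (t α j)) (abs_nonneg (t γ j)))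
      set x := |s α i|
      set x' := |s γ i|
      set y := |t α j|
      set y' := |t γ j|
      rw [abs_le]
      constructor <;> nlinarith [mul_nonneg S0 (sq_nonneg (x - x' - (y - y'))),
        mul_nonneg S0 (sq_nonneg (x - x' + (y - y')))]
    have h2 : ∑ i, ∑ j, A i j ^ 2 * (((|s α i| - |s γ i|) ^ 2 * (|s α i| + |s γ i|) *
          (|t α j| + |t γ j|) + (|t α j| - |t γ j|) ^ 2 * (|t α j| + |t γ j|) *
          (|s α i| + |s γ i|)) / 2) =
        ∑ i, (|s α i| - |s γ i|) ^ 2 * (|s α i| + |s γ i|) / 2 *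
          ∑ j, A i j ^ 2 * (|t α j| + |t γ j|) +
        ∑ j, (|t α j| - |t γ j|) ^ 2 * (|t α j| + |t γ j|) / 2 *
          ∑ i, A i j ^ 2 * (|s α i| + |s γ i|) := by
      simp only [Finset.mul_sum]
      rw [Finset.sum_comm (s := Finset.univ (α := κ)), ← Finset.sum_add_distrib]
      refine Finset.sum_congr rfl fun i _ => ?_
      rw [← Finset.sum_add_distrib]
      exact Finset.sum_congr rfl fun j _ => by ring
    have h3 : ∀ i, ∑ j, A i j ^ 2 * (|t α j| + |t γ j|) ≤ 2 * (a * D) := by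
      intro i
      calc _ ≤ ∑ j, a * |A i j| * (|t α j| + |t γ j|) := by gcongr with j; exact hb i j
        _ = a * ∑ j, |A i j| * |t α j| + a * ∑ j, |A i j| * |t γ j| := by
          rw [Finset.mul_sum, Finset.mul_sum, ← Finset.sum_add_distrib]
          exact Finset.sum_congr rfl fun j _ => by ring
        _ ≤ a * D + a * D := by gcongr <;> exact hAt _ i
        _ = _ := by ring
    have h4 : ∀ j, ∑ i, A i j ^ 2 * (|s α i| + |s γ i|) ≤ 2 * (a * D') := by
      intro j
      calc _ ≤ ∑ i, a * |A i j| * (|s α i| + |s γ i|) := by gcongr with i; exact hb i j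
        _ = a * ∑ i, |A i j| * |s α i| + a * ∑ i, |A i j| * |s γ i| := by
          rw [Finset.mul_sum, Finset.mul_sum, ← Finset.sum_add_distrib]
          exact Finset.sum_congr rfl fun j _ => by ring
        _ ≤ a * D' + a * D' := by gcongr <;> exact hAs _ j
        _ = _ := by ring
    have h5 : ∀ {x y M B : ℝ}, 0 ≤ x → 0 ≤ y → M ≤ 2 * B → 0 < B →
        (x - y) ^ 2 * (x + y) / 2 * M ≤ 2 * (B * (Real.sqrt x ^ 3 - Real.sqrt y ^ 3) ^ 2) := by
      intro x y M B hx hy hM hB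
      have k1 := sq_sub_mul_add_le hx hy
      have k2 : 0 ≤ (x - y) ^ 2 * (x + y) := by positivity
      nlinarith [mul_le_mul_of_nonneg_left hM k2, mul_le_mul_of_nonneg_left k1 hB.le]
    have h6 := Finset.sum_le_sum fun i (_ : i ∈ Finset.univ) =>
      h5 (abs_nonneg (s α i)) (abs_nonneg (s γ i)) (h3 i) (mul_pos ha hD)
    have h7 := Finset.sum_le_sum fun j (_ : j ∈ Finset.univ) =>
      h5 (abs_nonneg (t α j)) (abs_nonneg (t γ j)) (h4 j) (mul_pos ha hD')
    rw [← Finset.mul_sum] at h6 h7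
    rw [h2] at h1
    linarith
  · rw [e₃]
    have h4 := mul_le_mul_of_nonneg_left e₁ (Real.sqrt_nonneg (a * D))
    have h5 := mul_le_mul_of_nonneg_left e₂ (Real.sqrt_nonneg (a * D'))
    linarith [mul_sqrt_mul_le (L := L) ha.le hD.le, mul_sqrt_mul_le (L := L) ha.le hD'.le]
  · simp only [Fintype.sum_sum_type, Sum.elim_inl, Sum.elim_inr, mul_assoc, ← Finset.mul_sum]
    exact add_le_add
      (mul_le_mul_of_nonneg_left (sum_mul_le_of_sum_le_one (fun i => by positivity) (hs α)
        fun j => b₁ (g ∘ Sum.inl) j) (Real.sqrt_nonneg _))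
      (mul_le_mul_of_nonneg_left (sum_mul_le_of_sum_le_one (fun i => by positivity) (ht α)
        fun j => b₂ (g ∘ Sum.inr) j) (Real.sqrt_nonneg _))

end ErrorProcess

section FiniteNet

variable {ι κ : Type*} [Fintype ι] [Fintype κ]

theorem abs_le_of_sum_rpow_le {x : ι → ℝ} {r D : ℝ} (hr : 0 < r) (hD : 0 ≤ D)
    (h : ∑ i, |x i| ^ r ≤ D ^ r) (i : ι) : |x i| ≤ D := by
  refine (Real.rpow_le_rpow_iff (abs_nonneg _) hD hr).1 (le_trans ?_ h)
  exact Finset.single_le_sum (f := fun i => |x i| ^ r) (fun i _ => by positivity)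
    (Finset.mem_univ i)

theorem sum_rpow_le_one_of_le {x : ι → ℝ} {r r' : ℝ} (hr : 0 < r) (hrr' : r ≤ r')
    (h : ∑ i, |x i| ^ r ≤ 1) : ∑ i, |x i| ^ r' ≤ 1 := by
  refine le_trans (Finset.sum_le_sum fun i _ => ?_) h
  exact Real.rpow_le_rpow_of_exponent_ge' (abs_nonneg _)
    (abs_le_of_sum_rpow_le hr zero_le_one (by simpa using h) i) hr.le hrr'

theorem sum_sq_le_one {x : ι → ℝ} {r : ℝ} (hr : 0 < r) (hr2 : r ≤ 2)
    (h : ∑ i, |x i| ^ r ≤ 1) : ∑ i, x i ^ 2 ≤ 1 := by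
  simpa using sum_rpow_le_one_of_le hr hr2 h

theorem sum_sqrt_pow_le_one {x : ι → ℝ} {r : ℝ} (hr : 0 < r) (hr2 : r ≤ 3 / 2)
    (h : ∑ i, |x i| ^ r ≤ 1) : ∑ i, Real.sqrt |x i| ^ 3 ≤ 1 := by
  refine le_trans (le_of_eq (Finset.sum_congr rfl fun i _ => ?_)) (sum_rpow_le_one_of_le hr hr2 h)
  rw [Real.sqrt_eq_rpow, ← Real.rpow_natCast, ← Real.rpow_mul (abs_nonneg _)]
  norm_num

theorem sum_pow_four_le {x : ι → ℝ} {r a D : ℝ} (hr : 0 < r) (hr3 : r ≤ 3) (hD : 0 < D)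
    (ha : ∀ i, |x i| ≤ a) (ha0 : 0 ≤ a) (h : ∑ i, |x i| ^ r ≤ D ^ r) :
    ∑ i, x i ^ 4 ≤ a * D ^ 3 := by
  have h1 : ∑ i, |x i / D| ^ r ≤ 1 := by
    simp only [abs_div, abs_of_pos hD, Real.div_rpow (abs_nonneg _) hD.le]
    rw [← Finset.sum_div]
    exact (div_le_one (by positivity)).2 h
  have h2 : ∑ i, |x i / D| ^ 3 ≤ 1 := by
    have e : ∀ i, |x i / D| ^ (3 : ℝ) = |x i / D| ^ 3 := fun i =>
      mod_cast Real.rpow_natCast |x i / D| 3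
    simpa only [e] using sum_rpow_le_one_of_le hr hr3 h1
  have h3 : ∑ i, |x i| ^ 3 ≤ D ^ 3 := by
    simp only [abs_div, abs_of_pos hD, div_pow] at h2
    rwa [← Finset.sum_div, div_le_one (by positivity)] at h2
  calc ∑ i, x i ^ 4 ≤ ∑ i, a * |x i| ^ 3 := by
        refine Finset.sum_le_sum fun i _ => ?_
        have : x i ^ 4 = |x i| * |x i| ^ 3 := by
          rw [← pow_succ', Even.pow_abs (by decide)]
        rw [this]
        exact mul_le_mul_of_nonneg_right (ha i) (by positivity)
    _ = a * ∑ i, |x i| ^ 3 := by rw [Finset.mul_sum]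
    _ ≤ _ := by gcongr

theorem sum_abs_mul_abs_le {x y : ι → ℝ} {r r' D : ℝ} (hr : r.HolderConjugate r') (hD : 0 ≤ D)
    (hx : ∑ i, |x i| ^ r ≤ D ^ r) (hy : ∑ i, |y i| ^ r' ≤ 1) : ∑ i, |x i| * |y i| ≤ D := by
  have h := Real.inner_le_Lp_mul_Lq Finset.univ (fun i => |x i|) (fun i => |y i|) hr
  simp only [abs_abs] at h
  have h1 : (∑ i, |x i| ^ r) ^ (1 / r) ≤ D := by
    calc _ ≤ (D ^ r) ^ (1 / r) :=
          Real.rpow_le_rpow (Finset.sum_nonneg fun i _ => by positivity) hx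
            (one_div_nonneg.2 hr.nonneg)
      _ = D := by rw [← Real.rpow_mul hD, mul_one_div_cancel hr.ne_zero, Real.rpow_one]
  have h2 : (∑ i, |y i| ^ r') ^ (1 / r') ≤ 1 :=
    Real.rpow_le_one (Finset.sum_nonneg fun i _ => by positivity) hy
      (one_div_nonneg.2 hr.symm.nonneg)
  calc _ ≤ _ := h
    _ ≤ D * 1 := mul_le_mul h1 h2 (Real.rpow_nonneg
        (Finset.sum_nonneg fun i _ => by positivity) _) hD
    _ = D := mul_one D

theorem holderConjugate_le_two {P P' : ℝ} (h : P.HolderConjugate P') (hP : 2 ≤ P) : P' ≤ 2 := by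
  nlinarith [h.mul_eq_add]

theorem holderConjugate_le_three_halves {P P' : ℝ} (h : P.HolderConjugate P') (hP : 3 ≤ P) :
    P' ≤ 3 / 2 := by
  nlinarith [h.mul_eq_add]

/-- The bound for suprema of the bilinear Gaussian process over finitely many pairs. -/
theorem integral_le_of_finite_net [Nonempty ι] [Nonempty κ] {T : Type*} [Fintype T] [Nonempty T]
    {A : ι → κ → ℝ} {P P' Q Q' L a D D' : ℝ} (hP : 2 ≤ P) (hQ : 2 ≤ Q)
    (hPP' : P.HolderConjugate P') (hQQ' : Q.HolderConjugate Q') (hL : 1 ≤ L) (ha : 0 < a)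
    (hD : 0 < D) (hD' : 0 < D') (hA : ∀ i j, |A i j| ≤ a)
    (hAD : ∀ i, ∑ j, |A i j| ^ P ≤ D ^ P) (hAD' : ∀ j, ∑ i, |A i j| ^ Q ≤ D' ^ Q)
    (hι : (Fintype.card ι : ℝ) ≤ Real.exp L) (hκ : (Fintype.card κ : ℝ) ≤ Real.exp L)
    (s : T → ι → ℝ) (t : T → κ → ℝ) (hs : ∀ α, ∑ i, |s α i| ^ Q' ≤ 1)
    (ht : ∀ α, ∑ j, |t α j| ^ P' ≤ 1) {F : (ι × κ → ℝ) → ℝ}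
    (hF : Integrable F (_root_.stdGaussian (ι × κ)))
    (hFx : ∀ g, ∃ α, F g ≤ ∑ i, ∑ j, A i j * g (i, j) * s α i * t α j) :
    ∫ g, F g ∂_root_.stdGaussian (ι × κ) ≤
      22 * (Real.sqrt P * D + Real.sqrt Q * D' + L ^ 5 * a) := by
  have hP'0 : 0 < P' := hPP'.symm.pos
  have hQ'0 : 0 < Q' := hQQ'.symm.pos
  have hs2 : ∀ α, ∑ i, s α i ^ 2 ≤ 1 := fun α =>
    sum_sq_le_one hQ'0 (holderConjugate_le_two hQQ' hQ) (hs α)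
  have ht2 : ∀ α, ∑ j, t α j ^ 2 ≤ 1 := fun α =>
    sum_sq_le_one hP'0 (holderConjugate_le_two hPP' hP) (ht α)
  have hs1 : ∀ α i, |s α i| ≤ 1 := fun α =>
    abs_le_of_sum_rpow_le hQ'0 zero_le_one (by simpa using hs α)
  have ht1 : ∀ α j, |t α j| ≤ 1 := fun α =>
    abs_le_of_sum_rpow_le hP'0 zero_le_one (by simpa using ht α)
  obtain ⟨Ψ₁, i₁, e₁, b₁⟩ := exists_bound_rowNorm hQ hQQ' hL ha hD'.le hA hAD' hι hκ
  obtain ⟨Ψ₂, i₂, e₂, b₂⟩ := exists_bound_rowNorm (A := fun j i => A i j) hP hPP' hL ha hD.le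
    (fun j i => hA i j) hAD hκ hι
  have L2 : L ^ 2 * a ≤ L ^ 5 * a :=
    mul_le_mul_of_nonneg_right (pow_le_pow_right₀ hL (by norm_num)) ha.le
  have L4 : L ^ 4 * a ≤ L ^ 5 * a :=
    mul_le_mul_of_nonneg_right (pow_le_pow_right₀ hL (by norm_num)) ha.le
  have rP : D ≤ Real.sqrt P * D :=
    le_mul_of_one_le_left hD.le (Real.one_le_sqrt.2 (by linarith))
  have rQ : D' ≤ Real.sqrt Q * D' :=
    le_mul_of_one_le_left hD'.le (Real.one_le_sqrt.2 (by linarith))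
  rcases le_total P 3 with hP3 | hP3
  · obtain ⟨z, Ψ₃, hz, i₃, e₃, b₃⟩ := exists_errorProcess_of_row ha hD hL
      (fun i => sum_pow_four_le (by linarith) hP3 hD (hA i) ha.le (hAD i)) hι hκ s t hs2 ht2
    have := integral_bilinear_le A s t z hz hF i₁ i₂ i₃ hFx
      (fun g α => b₁ g _ _ (hs α) (hs1 α) (ht2 α)) (fun g α => b₂ g _ _ (ht α) (ht1 α) (hs2 α)) b₃
    linarith
  rcases le_total Q 3 with hQ3 | hQ3
  · obtain ⟨z, Ψ₃, hz, i₃, e₃, b₃⟩ := exists_errorProcess_of_row (A := fun j i => A i j) ha hD' hL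
      (fun j => sum_pow_four_le (by linarith) hQ3 hD' (fun i => hA i j) ha.le (hAD' j))
      hκ hι t s ht2 hs2
    have := integral_bilinear_le A s t z (fun α β => by
        refine le_trans (le_of_eq ?_) (hz α β)
        rw [Finset.sum_comm]
        congr 2
        exact Finset.sum_congr rfl fun j _ => Finset.sum_congr rfl fun i _ => by ring)
      hF i₁ i₂ i₃ hFx
      (fun g α => b₁ g _ _ (hs α) (hs1 α) (ht2 α)) (fun g α => b₂ g _ _ (ht α) (ht1 α) (hs2 α)) b₃
    linarith
  · obtain ⟨z, Ψ₃, hz, i₃, e₃, b₃⟩ := exists_errorProcess_of_sqrt ha hD hD' hL hA hι hκ s t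
      (fun α => sum_sqrt_pow_le_one hQ'0 (holderConjugate_le_three_halves hQQ' hQ3) (hs α))
      (fun α => sum_sqrt_pow_le_one hP'0 (holderConjugate_le_three_halves hPP' hP3) (ht α))
      (fun α i => sum_abs_mul_abs_le hPP' hD.le (hAD i) (ht α))
      (fun α j => sum_abs_mul_abs_le hQQ' hD'.le (hAD' j) (hs α))
    have := integral_bilinear_le A s t z hz hF i₁ i₂ i₃ hFx
      (fun g α => b₁ g _ _ (hs α) (hs1 α) (ht2 α)) (fun g α => b₂ g _ _ (ht α) (ht1 α) (hs2 α)) b₃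
    linarith

end FiniteNet

section OperatorNorm

theorem one_lt_toReal_of_conj {p r : ℝ≥0∞} (h : 1 / p + 1 / r = 1) (hr : 2 ≤ r) (hr' : r ≠ ⊤) :
    p ≠ ⊤ ∧ 2 ≤ r.toReal ∧ r.toReal.HolderConjugate p.toReal := by
  have hr2 : 2 ≤ r.toReal := by
    simpa using ENNReal.toReal_mono hr' hr
  have hpt : p ≠ ⊤ := by
    rintro rfl
    rw [ENNReal.div_top, zero_add, one_div, ENNReal.inv_eq_one] at h
    rw [h] at hr2; norm_num at hr2
  have hp0 : p ≠ 0 := by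
    rintro rfl
    simp at h
  refine ⟨hpt, hr2, Real.holderConjugate_iff.2 ⟨by linarith, ?_⟩⟩
  have hr0 : r ≠ 0 := by rintro rfl; norm_num at hr2
  have h2 := congrArg ENNReal.toReal h
  rw [ENNReal.toReal_add (by simpa using hp0) (by simpa using hr0)] at h2
  simp only [one_div, ENNReal.toReal_inv, ENNReal.toReal_one] at h2
  linarith

variable {ι κ : Type*} [Fintype ι] [Fintype κ]

theorem sum_rpow_le_of_lpNorm_le {r : ℝ≥0∞} (hr : r ≠ ⊤) (hr0 : 0 < r.toReal) {x : ι → ℝ} {D : ℝ}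
    (h : lpNorm r x ≤ D) : ∑ i, |x i| ^ r.toReal ≤ D ^ r.toReal := by
  rw [_root_.lpNorm, if_neg hr] at h
  have h0 : 0 ≤ ∑ i, |x i| ^ r.toReal := Finset.sum_nonneg fun i _ => by positivity
  have h1 := Real.rpow_le_rpow (by positivity) h hr0.le
  rwa [← Real.rpow_mul h0, one_div_mul_cancel hr0.ne', Real.rpow_one] at h1

theorem lpNorm_zero_le_one {r : ℝ≥0∞} (hr : r ≠ ⊤) (hr0 : 0 < r.toReal) :
    lpNorm r (0 : ι → ℝ) ≤ 1 := by
  rw [_root_.lpNorm, if_neg hr]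
  simp [Real.zero_rpow hr0.ne', Real.zero_rpow (inv_pos.2 hr0).ne']

theorem bilinear_sub_le {M : ι → κ → ℝ} {s s' : ι → ℝ} {t t' : κ → ℝ} {ε : ℝ}
    (ht : ∀ j, |t j| ≤ 1) (hs' : ∀ i, |s' i| ≤ 1) (hs : ∀ i, |s i - s' i| ≤ ε)
    (htt' : ∀ j, |t j - t' j| ≤ ε) :
    ∑ i, ∑ j, M i j * s i * t j ≤
      ∑ i, ∑ j, M i j * s' i * t' j + 2 * ε * ∑ i, ∑ j, |M i j| := by
  simp only [Finset.mul_sum, ← Finset.sum_add_distrib]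
  refine Finset.sum_le_sum fun i _ => Finset.sum_le_sum fun j _ => ?_
  have h1 : |s i * t j - s' i * t' j| ≤ 2 * ε := by
    have e : s i * t j - s' i * t' j = (s i - s' i) * t j + s' i * (t j - t' j) := by ring
    rw [e]
    refine (abs_add_le _ _).trans ?_
    rw [abs_mul, abs_mul]
    have ε0 : 0 ≤ ε := (abs_nonneg _).trans (hs i)
    nlinarith [mul_le_mul (hs i) (ht j) (abs_nonneg _) ε0,
      mul_le_mul (hs' i) (htt' j) (abs_nonneg _) zero_le_one]
  have h2 : M i j * (s i * t j - s' i * t' j) ≤ |M i j| * (2 * ε) :=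
    (le_abs_self _).trans (by rw [abs_mul]; gcongr)
  linarith

/-- Finite nets reduce the operator norm to finitely many bilinear forms. -/
theorem exists_finite_net {p r : ℝ≥0∞} (hp : p ≠ ⊤) (hp0 : 0 < p.toReal) (hr : r ≠ ⊤)
    (hr0 : 0 < r.toReal) {ε : ℝ} (hε : 0 < ε) :
    ∃ K : Set ((ι → ℝ) × (κ → ℝ)), K.Finite ∧ K.Nonempty ∧
      (∀ x ∈ K, lpNorm r x.1 ≤ 1 ∧ lpNorm p x.2 ≤ 1) ∧
      ∀ M : ι → κ → ℝ, ∃ x ∈ K, opNorm p r M ≤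
        ∑ i, ∑ j, M i j * x.1 i * x.2 j + 2 * ε * ∑ i, ∑ j, |M i j| := by
  set B : Set ((ι → ℝ) × (κ → ℝ)) := {x | lpNorm r x.1 ≤ 1 ∧ lpNorm p x.2 ≤ 1} with hB
  have b1 : ∀ x ∈ B, (∀ i, |x.1 i| ≤ 1) ∧ ∀ j, |x.2 j| ≤ 1 := fun x hx =>
    ⟨abs_le_of_sum_rpow_le hr0 zero_le_one (sum_rpow_le_of_lpNorm_le hr hr0 hx.1),
      abs_le_of_sum_rpow_le hp0 zero_le_one (sum_rpow_le_of_lpNorm_le hp hp0 hx.2)⟩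
  have tb : TotallyBounded B := by
    refine (isCompact_closedBall (0 : (ι → ℝ) × (κ → ℝ)) 1).totallyBounded.subset fun x hx => ?_
    rw [mem_closedBall_zero_iff, Prod.norm_def, max_le_iff, pi_norm_le_iff_of_nonneg zero_le_one,
      pi_norm_le_iff_of_nonneg zero_le_one]
    exact b1 x hx
  obtain ⟨K, hKB, hK, hBK⟩ := Metric.finite_approx_of_totallyBounded tb ε hε
  have h0 : (0 : (ι → ℝ) × (κ → ℝ)) ∈ B := ⟨lpNorm_zero_le_one hr hr0, lpNorm_zero_le_one hp hp0⟩
  have approx : ∀ M : ι → κ → ℝ, ∀ x ∈ B, ∃ y ∈ K, ∑ i, ∑ j, M i j * x.1 i * x.2 j ≤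
      ∑ i, ∑ j, M i j * y.1 i * y.2 j + 2 * ε * ∑ i, ∑ j, |M i j| := by
    intro M x hx
    obtain ⟨y, hy, hxy⟩ := Set.mem_iUnion₂.1 (hBK hx)
    rw [Metric.mem_ball, Prod.dist_eq, max_lt_iff] at hxy
    refine ⟨y, hy, bilinear_sub_le (b1 x hx).2 (b1 y (hKB hy)).1 (fun i => ?_) fun j => ?_⟩
    · exact (dist_le_pi_dist x.1 y.1 i).trans hxy.1.le
    · exact (dist_le_pi_dist x.2 y.2 j).trans hxy.2.le
  have hKne : K.Nonempty := by
    obtain ⟨y, hy, -⟩ := approx 0 0 h0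
    exact ⟨y, hy⟩
  refine ⟨K, hK, hKne, fun x hx => hKB hx, fun M => ?_⟩
  obtain ⟨x, hx, hmax⟩ := Set.exists_max_image K
    (fun y => ∑ i, ∑ j, M i j * y.1 i * y.2 j) hK hKne
  refine ⟨x, hx, csSup_le ⟨_, 0, 0, h0.1, h0.2, rfl⟩ ?_⟩
  rintro _ ⟨s, t, hs, ht, rfl⟩
  obtain ⟨y, hy, hxy⟩ := approx M (s, t) ⟨hs, ht⟩
  exact hxy.trans (by linarith [hmax y hy])

theorem opNorm_nonneg {p r : ℝ≥0∞} (hp : p ≠ ⊤) (hp0 : 0 < p.toReal) (hr : r ≠ ⊤)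
    (hr0 : 0 < r.toReal) (M : ι → κ → ℝ) : 0 ≤ opNorm p r M :=
  Real.sSup_nonneg' ⟨0, ⟨0, 0, lpNorm_zero_le_one hr hr0, lpNorm_zero_le_one hp hp0, by simp⟩, le_rfl⟩

theorem integrable_bilinear (A : ι → κ → ℝ) (s : ι → ℝ) (t : κ → ℝ) :
    Integrable (fun g : ι × κ → ℝ => ∑ i, ∑ j, A i j * g (i, j) * s i * t j)
      (_root_.stdGaussian (ι × κ)) :=
  integrable_finsetSum _ fun i _ => integrable_finsetSum _ fun j _ =>
    (((integrable_eval_stdGaussian (i, j)).const_mul (A i j)).mul_const _).mul_const _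

theorem integrable_sum_abs (A : ι → κ → ℝ) :
    Integrable (fun g : ι × κ → ℝ => ∑ i, ∑ j, |A i j * g (i, j)|)
      (_root_.stdGaussian (ι × κ)) :=
  integrable_finsetSum _ fun i _ => integrable_finsetSum _ fun j _ =>
    ((integrable_eval_stdGaussian (i, j)).const_mul (A i j)).abs

theorem integrable_sup' {Ω T : Type*} [MeasurableSpace Ω] {ν : Measure Ω} [Fintype T] [Nonempty T]
    {f : T → Ω → ℝ} (hf : ∀ α, Integrable (f α) ν) :
    Integrable (fun x => Finset.univ.sup' Finset.univ_nonempty fun α => f α x) ν := by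
  have h : ∀ s : Finset T, ∀ hs : s.Nonempty, Integrable (s.sup' hs f) ν := by
    intro s hs
    induction hs using Finset.Nonempty.cons_induction with
    | singleton α => simpa using hf α
    | cons α s hα hs ih => rw [Finset.sup'_cons hs]; exact (hf α).sup ih
  convert h Finset.univ Finset.univ_nonempty using 1
  ext x
  rw [Finset.sup'_apply]

theorem integral_opNorm_le [Nonempty ι] [Nonempty κ] {p pstar q qstar : ℝ≥0∞}
    (hp : 1 / p + 1 / pstar = 1) (hq : 1 / q + 1 / qstar = 1) (hp2 : 2 ≤ pstar) (hpt : pstar ≠ ⊤)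
    (hq2 : 2 ≤ q) (hqt : q ≠ ⊤) {A : ι → κ → ℝ} {L a D D' ε : ℝ} (hε : 0 < ε) (hL : 1 ≤ L)
    (ha : 0 < a) (hD : 0 < D) (hD' : 0 < D') (hA : ∀ i j, |A i j| ≤ a)
    (hAD : ∀ i, lpNorm pstar (A i) ≤ D) (hAD' : ∀ j, lpNorm q (fun i => A i j) ≤ D')
    (hι : (Fintype.card ι : ℝ) ≤ Real.exp L) (hκ : (Fintype.card κ : ℝ) ≤ Real.exp L) :
    ∫ g : ι × κ → ℝ, opNorm p qstar (fun i j => A i j * g (i, j)) ∂_root_.stdGaussian (ι × κ) ≤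
      22 * (Real.sqrt pstar.toReal * D + Real.sqrt q.toReal * D' + L ^ 5 * a) +
        2 * ε * ∫ g : ι × κ → ℝ, ∑ i, ∑ j, |A i j * g (i, j)| ∂_root_.stdGaussian (ι × κ) := by
  obtain ⟨hp', hP, hPP'⟩ := one_lt_toReal_of_conj hp hp2 hpt
  obtain ⟨hq', hQ, hQQ'⟩ := one_lt_toReal_of_conj (by rwa [add_comm] at hq) hq2 hqt
  have hp0 := hPP'.symm.pos
  have hq0 := hQQ'.symm.pos
  obtain ⟨K, hK, hKne, hK1, hK2⟩ := exists_finite_net (ι := ι) (κ := κ) hp' hp0 hq' hq0 hε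
  have := hK.fintype
  have := hKne.to_subtype
  have iF := integrable_sup' (T := K) fun α => integrable_bilinear A α.1.1 α.1.2
  have main := integral_le_of_finite_net hP hQ hPP' hQQ' hL ha hD hD' hA
    (fun i => sum_rpow_le_of_lpNorm_le hpt (by linarith) (hAD i))
    (fun j => sum_rpow_le_of_lpNorm_le hqt (by linarith) (hAD' j)) hι hκ
    (fun α : K => α.1.1) (fun α : K => α.1.2)
    (fun α => by simpa using sum_rpow_le_of_lpNorm_le hq' hq0 (hK1 α.1 α.2).1)
    (fun α => by simpa using sum_rpow_le_of_lpNorm_le hp' hp0 (hK1 α.1 α.2).2) iF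
    (fun g => by
      obtain ⟨α, -, hα⟩ := Finset.exists_mem_eq_sup' Finset.univ_nonempty
        fun α : K => ∑ i, ∑ j, A i j * g (i, j) * α.1.1 i * α.1.2 j
      exact ⟨α, hα.le⟩)
  have iA := (integrable_sum_abs A).const_mul (2 * ε)
  refine (integral_mono_of_nonneg (.of_forall fun g => opNorm_nonneg hp' hp0 hq' hq0 _)
    (iF.add iA) (.of_forall fun g => ?_)).trans ?_
  · obtain ⟨x, hx, h⟩ := hK2 fun i j => A i j * g (i, j)
    refine h.trans (add_le_add_left ?_ _)
    exact Finset.le_sup' (fun α : K => ∑ i, ∑ j, A i j * g (i, j) * α.1.1 i * α.1.2 j)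
      (Finset.mem_univ (⟨x, hx⟩ : K))
  · rw [integral_add' iF iA, integral_const_mul]
    linarith

end OperatorNorm

theorem one_le_Log (x : ℝ) : 1 ≤ Log x := le_max_left _ _

theorem le_exp_Log {x y : ℝ} (hy : 0 < y) (h : x ≤ y) : x ≤ Real.exp (Log y) :=
  h.trans ((Real.exp_log hy).symm.le.trans (Real.exp_le_exp.2 (le_max_right _ _)))

theorem lpNorm_vec_nonneg (r : ℝ≥0∞) {ι : Type*} [Fintype ι] (x : ι → ℝ) : 0 ≤ lpNorm r x := by
  unfold _root_.lpNorm
  split_ifs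
  · exact Real.iSup_nonneg fun i => abs_nonneg _
  · exact Real.rpow_nonneg (Finset.sum_nonneg fun i _ => by positivity) _

/-- Proposition: crude bound with `Log^5`:
`E‖G_A‖_{p→q} ≤ C (√(p*) D1 + √q D2 + Log^5(mn) max_{i,j}|a_{ij}|)`. -/
theorem prop_worseD3 :
    ∃ C : ℝ, 0 < C ∧
      ∀ p pstar q qstar : ℝ≥0∞,
        1 / p + 1 / pstar = 1 → 1 / q + 1 / qstar = 1 →
        2 ≤ pstar → pstar ≠ ⊤ → 2 ≤ q → q ≠ ⊤ →
        ∀ (m n : ℕ), 0 < m → 0 < n → ∀ A : Fin m → Fin n → ℝ,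
          EopNorm p qstar A ≤
            C * (Real.sqrt pstar.toReal * D1 pstar A + Real.sqrt q.toReal * D2 q A +
              Log ((m : ℝ) * (n : ℝ)) ^ (5 : ℕ) * maxEntry A) := by
  refine ⟨22, by norm_num, fun p pstar q qstar hp hq hp2 hpt hq2 hqt m n hm hn A => ?_⟩
  have := Fin.pos_iff_nonempty.1 hm
  have := Fin.pos_iff_nonempty.1 hn
  have hm1 : (1 : ℝ) ≤ m := mod_cast hm
  have hn1 : (1 : ℝ) ≤ n := mod_cast hn
  set L := Log ((m : ℝ) * (n : ℝ))
  have hL : 1 ≤ L := one_le_Log _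
  have hι : (Fintype.card (Fin m) : ℝ) ≤ Real.exp L := by
    rw [Fintype.card_fin]; exact le_exp_Log (by positivity) (by nlinarith)
  have hκ : (Fintype.card (Fin n) : ℝ) ≤ Real.exp L := by
    rw [Fintype.card_fin]; exact le_exp_Log (by positivity) (by nlinarith)
  have a0 : 0 ≤ maxEntry A := Real.iSup_nonneg fun _ => abs_nonneg _
  have d0 : 0 ≤ D1 pstar A := Real.iSup_nonneg fun _ => lpNorm_vec_nonneg _ _
  have d0' : 0 ≤ D2 q A := Real.iSup_nonneg fun _ => lpNorm_vec_nonneg _ _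
  set I := ∫ g : Fin m × Fin n → ℝ, ∑ i, ∑ j, |A i j * g (i, j)|
    ∂_root_.stdGaussian (Fin m × Fin n)
  have I0 : 0 ≤ I := integral_nonneg fun g =>
    Finset.sum_nonneg fun i _ => Finset.sum_nonneg fun j _ => abs_nonneg _
  set M := 22 * (Real.sqrt pstar.toReal + Real.sqrt q.toReal + L ^ 5) + 2 * I
  have M0 : 0 < M := by positivity
  refine le_of_forall_pos_le_add fun δ hδ => ?_
  have hε : 0 < δ / M := by positivity
  have h := integral_opNorm_le hp hq hp2 hpt hq2 hqt (A := A) hε hL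
    (a := maxEntry A + δ / M) (D := D1 pstar A + δ / M) (D' := D2 q A + δ / M)
    (by positivity) (by positivity) (by positivity)
    (fun i j => (le_ciSup (f := fun ij : Fin m × Fin n => |A ij.1 ij.2|)
      (Set.finite_range _).bddAbove (i, j)).trans (le_add_of_nonneg_right hε.le))
    (fun i => (le_ciSup (f := fun i => lpNorm pstar fun j => A i j)
      (Set.finite_range _).bddAbove i).trans (le_add_of_nonneg_right hε.le))
    (fun j => (le_ciSup (f := fun j => lpNorm q fun i => A i j)
      (Set.finite_range _).bddAbove j).trans (le_add_of_nonneg_right hε.le)) hι hκ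
  refine h.trans (le_of_eq ?_)
  have e : δ = M * (δ / M) := by field_simp
  conv_rhs => rw [e]
  ring
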